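/- arXiv:2003.00909 — 2 statements merged into one kernel-verified Lean document; each statement's English description precedes it below -/
import Mathlib

section
/- Let d ≥ 2, let K ⊆ ℝ^d be a convex body with λ_d(K) = 1, and let S be a set of n points chosen uniformly and independently at random from K. Then the expected number of (d+1)-holes (empty simplices) in S is at most 2^{d−1} · d! · binom(n,d). -/
open MeasureTheory

theorem inv_factorial_le_volume_cornerSimplex {ι : Type*} [Fintype ι] :
    ENNReal.ofReal (1 / (Fintype.card ι).factorial) ≤
      volume {x : ι → ℝ | (∀ i, 0 ≤ x i) ∧ ∑ i, x i ≤ 1} := by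
  classical
  set D : Set (ι → ℝ) := {x | (∀ i, 0 ≤ x i) ∧ ∑ i, x i ≤ 1} with hD
  have hDm : MeasurableSet D := by
    refine IsClosed.measurableSet ?_
    have h1 : IsClosed {x : ι → ℝ | ∀ i, 0 ≤ x i} := by
      simp only [Set.ofPred_forall]
      exact isClosed_iInter fun i => isClosed_le continuous_const (continuous_apply i)
    exact h1.inter (isClosed_le (f := fun x : ι → ℝ => ∑ i, x i) (by fun_prop) continuous_const)
  let flip (ε : ι → Bool) (x : ι → ℝ) : ι → ℝ := fun i => (if ε i then id else Neg.neg) (x i)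
  have hflip (ε : ι → Bool) : MeasurePreserving (flip ε) := by
    refine volume_preserving_pi fun i => ?_
    by_cases h : ε i
    · simpa [h] using MeasurePreserving.id volume
    · simpa [h] using Measure.measurePreserving_neg (volume : Measure ℝ)
  have hcover : {x : ι → ℝ | ∑ i, |x i| ^ (1 : ℝ) < 1} ⊆ ⋃ ε : ι → Bool, flip ε ⁻¹' D := by
    intro x hx
    simp only [Real.rpow_one, Set.mem_ofPred_eq] at hx
    refine Set.mem_iUnion.2 ⟨fun i => decide (0 ≤ x i), ?_⟩
    have habs : flip (fun i => decide (0 ≤ x i)) x = fun i => |x i| := by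
      funext i
      by_cases h : 0 ≤ x i
      · simp [flip, h, abs_of_nonneg h]
      · simp [flip, h, abs_of_neg (not_le.1 h)]
    simp only [Set.mem_preimage, habs, hD, Set.mem_ofPred_eq]
    exact ⟨fun i => abs_nonneg _, hx.le⟩
  have hle := (measure_mono hcover).trans (measure_iUnion_fintype_le volume _)
  rw [volume_sum_rpow_lt_one ι le_rfl] at hle
  simp only [(hflip _).measure_preimage hDm.nullMeasurableSet, Finset.sum_const, Finset.card_univ,
    Fintype.card_pi, Fintype.card_bool, Finset.prod_const, nsmul_eq_mul] at hle
  rw [div_one, div_one, one_add_one_eq_two, Real.Gamma_two, mul_one,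
    Real.Gamma_nat_eq_factorial, div_eq_mul_one_div, ENNReal.ofReal_mul (by positivity)] at hle
  rw [ENNReal.ofReal_pow (by norm_num)] at hle
  push_cast at hle
  rw [ENNReal.ofReal_ofNat] at hle
  exact (ENNReal.mul_le_mul_iff_right (by positivity) (by finiteness)).1 hle

theorem volume_halfCube_le (m : ℕ) :
    volume {x : Fin (m + 1) → ℝ | (∀ i, |x i| ≤ 1) ∧ 0 ≤ ∑ i, x i} ≤ 2 ^ m := by
  set H : Set (Fin (m + 1) → ℝ) := {x | (∀ i, |x i| ≤ 1) ∧ 0 ≤ ∑ i, x i} with hH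
  have hHm : MeasurableSet H := by
    refine IsClosed.measurableSet ?_
    have h1 : IsClosed {x : Fin (m + 1) → ℝ | ∀ i, |x i| ≤ 1} := by
      simp only [Set.ofPred_forall]
      exact isClosed_iInter fun i => isClosed_le (by fun_prop) continuous_const
    exact h1.inter (isClosed_le (g := fun x : Fin (m + 1) → ℝ => ∑ i, x i) continuous_const
      (by fun_prop))
  have hnull : volume (H ∩ Neg.neg ⁻¹' H) = 0 := by
    let φ : (Fin (m + 1) → ℝ) →ₗ[ℝ] ℝ := ∑ i, LinearMap.proj i
    refine measure_mono_null (t := (LinearMap.ker φ : Set (Fin (m + 1) → ℝ))) ?_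
      (Measure.addHaar_submodule _ _ fun h => ?_)
    · rintro x ⟨⟨-, h1⟩, -, h2⟩
      simp only [Pi.neg_apply, Finset.sum_neg_distrib] at h2
      simp only [SetLike.mem_coe, LinearMap.mem_ker, φ, LinearMap.sum_apply, LinearMap.proj_apply]
      linarith
    · have : Pi.single 0 1 ∈ LinearMap.ker φ := h ▸ Submodule.mem_top
      simp [φ, LinearMap.sum_apply] at this
  have hneg : volume (Neg.neg ⁻¹' H) = volume H :=
    (Measure.measurePreserving_neg (volume : Measure (Fin (m + 1) → ℝ))).measure_preimage
      hHm.nullMeasurableSet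
  have hcube : volume (Set.Icc (fun _ => -1 : Fin (m + 1) → ℝ) fun _ => 1) = 2 * 2 ^ m := by
    rw [Real.volume_Icc_pi]
    norm_num [pow_succ, mul_comm]
  have hunion := measure_union_add_inter₀ (μ := volume) H
    (t := Neg.neg ⁻¹' H) (measurable_neg hHm).nullMeasurableSet
  rw [hnull, hneg, add_zero, ← two_mul] at hunion
  have hsub : H ∪ Neg.neg ⁻¹' H ⊆ Set.Icc (fun _ => -1 : Fin (m + 1) → ℝ) fun _ => 1 := by
    rintro x (⟨h, -⟩ | ⟨h, -⟩)
    · exact ⟨fun i => (abs_le.1 (h i)).1, fun i => (abs_le.1 (h i)).2⟩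
    · simp only [Pi.neg_apply, abs_neg] at h
      exact ⟨fun i => (abs_le.1 (h i)).1, fun i => (abs_le.1 (h i)).2⟩
  have := measure_mono (μ := volume) hsub
  rw [hunion, hcube] at this
  exact (ENNReal.mul_le_mul_iff_right (by norm_num) (by norm_num)).1 this

theorem lintegral_pow_one_sub_abs_le {a : ℝ} (ha : 0 < a) (k : ℕ) :
    ∫⁻ s : ℝ in {s | a * |s| ≤ 1}, ENNReal.ofReal (1 - a * |s|) ^ k ≤
      ENNReal.ofReal (2 / (a * (k + 1))) := by
  have hcont : Continuous fun s : ℝ => ENNReal.ofReal (1 - a * |s|) ^ k :=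
    (ENNReal.continuous_pow k).comp (ENNReal.continuous_ofReal.comp (by fun_prop))
  have hpos : ∫⁻ s : ℝ in Set.Icc 0 (1 / a), ENNReal.ofReal (1 - a * |s|) ^ k =
      ENNReal.ofReal (1 / (a * (k + 1))) := by
    have h1 : ∫⁻ s : ℝ in Set.Icc 0 (1 / a), ENNReal.ofReal (1 - a * |s|) ^ k =
        ∫⁻ s : ℝ in Set.Icc 0 (1 / a), ENNReal.ofReal ((1 - a * s) ^ k) := by
      refine setLIntegral_congr_fun measurableSet_Icc fun s hs => ?_
      have : a * s ≤ 1 := by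
        have := mul_le_mul_of_nonneg_left hs.2 ha.le
        rwa [mul_one_div_cancel ha.ne'] at this
      simp only [abs_of_nonneg hs.1]
      rw [ENNReal.ofReal_pow (by linarith)]
    rw [h1, ← ofReal_integral_eq_lintegral_ofReal]
    · congr 1
      rw [integral_Icc_eq_integral_Ioc, ← intervalIntegral.integral_of_le (by positivity)]
      rw [intervalIntegral.integral_eq_sub_of_hasDerivAt
        (f := fun s => -(1 - a * s) ^ (k + 1) / (a * (k + 1)))]
      · field_simp
        simp
      · intro s _
        have := ((((hasDerivAt_id s).const_mul a).const_sub 1).pow (k + 1)).neg.div_const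
          (a * (k + 1))
        convert! this using 1
        simp
        field_simp
      · exact Continuous.intervalIntegrable (by fun_prop) _ _
    · exact (Continuous.integrableOn_Icc (by fun_prop))
    · refine (ae_restrict_iff' measurableSet_Icc).2 (.of_forall fun s hs => ?_)
      have : a * s ≤ 1 := by
        have := mul_le_mul_of_nonneg_left hs.2 ha.le
        rwa [mul_one_div_cancel ha.ne'] at this
      exact pow_nonneg (by linarith) _
  have hneg : ∫⁻ s : ℝ in Neg.neg ⁻¹' Set.Icc 0 (1 / a), ENNReal.ofReal (1 - a * |s|) ^ k =
      ENNReal.ofReal (1 / (a * (k + 1))) := by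
    rw [← hpos, ← (Measure.measurePreserving_neg (volume : Measure ℝ)).setLIntegral_comp_preimage
      measurableSet_Icc hcont.measurable]
    simp
  have hsub : {s | a * |s| ≤ 1} ⊆ Set.Icc 0 (1 / a) ∪ Neg.neg ⁻¹' Set.Icc 0 (1 / a) := by
    intro s hs
    have hs' : |s| ≤ 1 / a := by rw [le_div_iff₀ ha]; linarith [show a * |s| ≤ 1 from hs]
    rcases le_total 0 s with h | h
    · exact .inl ⟨h, (le_abs_self s).trans hs'⟩
    · exact .inr ⟨by simpa using h, (neg_le_abs s).trans hs'⟩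
  refine (lintegral_mono_set hsub).trans ((lintegral_union_le _ _ _).trans ?_)
  rw [hpos, hneg, ← ENNReal.ofReal_add (by positivity) (by positivity)]
  apply le_of_eq
  congr 1
  ring

/-- The linear endomorphism of Euclidean space with prescribed columns. -/
noncomputable def columnMap {d : ℕ} (v : Fin d → EuclideanSpace ℝ (Fin d)) :
    EuclideanSpace ℝ (Fin d) →ₗ[ℝ] EuclideanSpace ℝ (Fin d) :=
  (EuclideanSpace.basisFun (Fin d) ℝ).toBasis.constr ℝ v

theorem columnMap_apply {d : ℕ} (v : Fin d → EuclideanSpace ℝ (Fin d))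
    (z : EuclideanSpace ℝ (Fin d)) : columnMap v z = ∑ i, z i • v i := by
  simp [columnMap, Module.Basis.constr_apply_fintype]

theorem det_columnMap_cons {d : ℕ} (z : EuclideanSpace ℝ (Fin (d + 1))) :
    LinearMap.det (columnMap (Fin.cons z fun i : Fin d => EuclideanSpace.single i.succ 1)) =
      z 0 := by
  rw [← LinearMap.det_toMatrix (EuclideanSpace.basisFun (Fin (d + 1)) ℝ).toBasis,
    Matrix.det_of_isLowerTriangular]
  · rw [Fin.prod_univ_succ]
    simp [LinearMap.toMatrix_apply, columnMap_apply, PiLp.single_apply]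
  · intro i j hij
    have hij : i < j := hij
    obtain ⟨j, rfl⟩ := Fin.exists_succ_eq.2 (Fin.ne_zero_of_lt hij)
    simp [LinearMap.toMatrix_apply, columnMap_apply, PiLp.single_apply, hij.ne]

theorem volume_convexHull_insert_range_add_ge {d : ℕ} (p : EuclideanSpace ℝ (Fin d))
    (v : Fin d → EuclideanSpace ℝ (Fin d)) :
    ENNReal.ofReal (|LinearMap.det (columnMap v)| / d.factorial) ≤
      volume (convexHull ℝ (insert p (Set.range fun i => p + v i))) := by
  set D : Set (Fin d → ℝ) := {x | (∀ i, 0 ≤ x i) ∧ ∑ i, x i ≤ 1} with hD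
  have hvol : ENNReal.ofReal (1 / d.factorial) ≤
      volume ((WithLp.ofLp : EuclideanSpace ℝ (Fin d) → _) ⁻¹' D) := by
    have h := (EuclideanSpace.volume_preserving_symm_measurableEquiv_toLp
      (Fin d)).measure_preimage_equiv D
    have h2 := inv_factorial_le_volume_cornerSimplex (ι := Fin d)
    rw [Fintype.card_fin, ← hD, ← h] at h2
    exact h2
  have hsub : (fun x => p + x) '' (columnMap v '' (WithLp.ofLp ⁻¹' D)) ⊆
      convexHull ℝ (insert p (Set.range fun i => p + v i)) := by
    rintro _ ⟨_, ⟨z, ⟨hz, hz1⟩, rfl⟩, rfl⟩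
    have hmem := (convex_convexHull ℝ (insert p (Set.range fun i => p + v i))).sum_mem
      (t := Finset.univ) (w := fun o : Option (Fin d) => o.elim (1 - ∑ i, z i) z)
      (z := fun o => o.elim p fun i => p + v i) ?_ ?_ ?_
    · convert hmem using 1
      rw [Fintype.sum_option, columnMap_apply]
      simp only [Option.elim, smul_add, Finset.sum_add_distrib, ← Finset.sum_smul, sub_smul]
      module
    · rintro (_ | i) -
      · simpa using hz1
      · exact hz i
    · simp [Fintype.sum_option]
    · rintro (_ | i) -
      · exact subset_convexHull _ _ (Set.mem_insert _ _)
      · exact subset_convexHull _ _ (Set.mem_insert_of_mem _ ⟨i, rfl⟩)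
  refine le_trans ?_ (measure_mono hsub)
  rw [Set.image_add_left, measure_preimage_add, Measure.addHaar_image_linearMap, div_eq_mul_one_div,
    ENNReal.ofReal_mul (abs_nonneg _)]
  gcongr

/-- The columns of the linear chart adapted to a facet: the first coordinate direction, followed
by the edge vectors of the facet at its first vertex. -/
noncomputable def facetColumns {d : ℕ} (q : Fin (d + 1) → EuclideanSpace ℝ (Fin (d + 1))) :
    Fin (d + 1) → EuclideanSpace ℝ (Fin (d + 1)) :=
  Fin.cons (EuclideanSpace.single 0 1) fun i : Fin d => q i.succ - q 0

theorem volume_convexHull_insert_facet_ge {d : ℕ}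
    (q : Fin (d + 1) → EuclideanSpace ℝ (Fin (d + 1))) (z : EuclideanSpace ℝ (Fin (d + 1))) :
    ENNReal.ofReal (|LinearMap.det (columnMap (facetColumns q))| / (d + 1).factorial * |z 0|) ≤
      volume (convexHull ℝ
        (insert (q 0 + columnMap (facetColumns q) z) (Set.range q))) := by
  set T := columnMap (facetColumns q)
  let w : Fin (d + 1) → EuclideanSpace ℝ (Fin (d + 1)) :=
    Fin.cons z fun i : Fin d => EuclideanSpace.single i.succ 1
  have hcomp : columnMap (fun i => T (w i)) = T ∘ₗ columnMap w := by
    ext1 x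
    simp [columnMap_apply]
  have hdet : LinearMap.det (columnMap fun i => T (w i)) = LinearMap.det T * z 0 := by
    rw [hcomp, LinearMap.det_comp, det_columnMap_cons]
  have h := volume_convexHull_insert_range_add_ge (q 0) fun i => T (w i)
  rw [hdet, abs_mul, mul_div_right_comm] at h
  refine h.trans (measure_mono (convexHull_mono ?_))
  rintro x (rfl | ⟨i, rfl⟩)
  · exact Set.mem_insert_of_mem _ ⟨0, rfl⟩
  · refine Fin.cases ?_ (fun i => ?_) i
    · exact Set.mem_insert _ _
    · refine Set.mem_insert_of_mem _ ⟨i.succ, ?_⟩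
      simp [w, T, columnMap_apply, facetColumns, PiLp.single_apply]

/-- The points whose projection along the first coordinate axis is an affine combination, with
coefficients of absolute value at most one, of the projections of the points of `q`. -/
def facetRegion {d : ℕ} (q : Fin (d + 1) → EuclideanSpace ℝ (Fin (d + 1))) :
    Set (EuclideanSpace ℝ (Fin (d + 1))) :=
  {x | ∃ b : Fin (d + 1) → ℝ, ∃ s : ℝ, (∀ i, |b i| ≤ 1) ∧ ∑ i, b i = 1 ∧
    x = ∑ i, b i • q i + s • EuclideanSpace.single 0 1}

theorem exists_chart_of_mem_facetRegion {d : ℕ}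
    {q : Fin (d + 1) → EuclideanSpace ℝ (Fin (d + 1))} {x : EuclideanSpace ℝ (Fin (d + 1))}
    (hx : x ∈ facetRegion q) :
    ∃ z : EuclideanSpace ℝ (Fin (d + 1)), ((∀ i : Fin d, |z i.succ| ≤ 1) ∧
      0 ≤ ∑ i : Fin d, z i.succ) ∧ q 0 + columnMap (facetColumns q) z = x := by
  obtain ⟨b, s, hb, hb1, rfl⟩ := hx
  refine ⟨WithLp.toLp 2 (Fin.cons s fun i => b i.succ), ⟨fun i => by simpa using hb i.succ, ?_⟩, ?_⟩
  · have := (abs_le.1 (hb 0)).2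
    rw [Fin.sum_univ_succ] at hb1
    simp only [Fin.cons_succ]
    linarith
  · rw [Fin.sum_univ_succ] at hb1
    rw [columnMap_apply, Fin.sum_univ_succ, Fin.sum_univ_succ]
    simp only [facetColumns, Fin.cons_zero, Fin.cons_succ, smul_sub, Finset.sum_sub_distrib,
      ← Finset.sum_smul]
    rw [← eq_sub_iff_add_eq] at hb1
    rw [hb1]
    module

theorem setLIntegral_fst_coord_le (m k : ℕ) {a : ℝ} (ha : 0 < a) :
    ∫⁻ z : EuclideanSpace ℝ (Fin (m + 2)) in
      {z | ((∀ i : Fin (m + 1), |z i.succ| ≤ 1) ∧ 0 ≤ ∑ i : Fin (m + 1), z i.succ) ∧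
        a * |z 0| ≤ 1}, ENNReal.ofReal (1 - a * |z 0|) ^ k ≤
      ENNReal.ofReal (2 / (a * (k + 1))) * 2 ^ m := by
  set H : Set (Fin (m + 1) → ℝ) := {x | (∀ i, |x i| ≤ 1) ∧ 0 ≤ ∑ i, x i}
  set J : Set ℝ := {s | a * |s| ≤ 1}
  have hmp := (EuclideanSpace.volume_preserving_symm_measurableEquiv_toLp (Fin (m + 2))).trans
    (volume_preserving_piFinSuccAbove (fun _ => ℝ) 0)
  have := hmp.setLIntegral_comp_preimage_emb (MeasurableEquiv.measurableEmbedding _)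
    (fun y : ℝ × (Fin (m + 1) → ℝ) => ENNReal.ofReal (1 - a * |y.1|) ^ k * 1) (J ×ˢ H)
  have hset : {z : EuclideanSpace ℝ (Fin (m + 2)) | ((∀ i : Fin (m + 1), |z i.succ| ≤ 1) ∧
      0 ≤ ∑ i : Fin (m + 1), z i.succ) ∧ a * |z 0| ≤ 1} =
      ((MeasurableEquiv.toLp 2 (Fin (m + 2) → ℝ)).symm.trans
        (MeasurableEquiv.piFinSuccAbove (fun _ => ℝ) 0)) ⁻¹' (J ×ˢ H) := by
    ext z
    exact and_comm
  rw [hset]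
  calc _ = ∫⁻ y : ℝ × (Fin (m + 1) → ℝ) in J ×ˢ H, ENNReal.ofReal (1 - a * |y.1|) ^ k * 1 := by
        rw [← this]
        simp only [mul_one]
        rfl
    _ = (∫⁻ s in J, ENNReal.ofReal (1 - a * |s|) ^ k) * volume H := by
        rw [Measure.volume_eq_prod, ← Measure.prod_restrict,
          lintegral_prod_mul (f := fun s : ℝ => ENNReal.ofReal (1 - a * |s|) ^ k)
            (g := fun _ => 1) (by fun_prop) (by fun_prop)]
        simp
    _ ≤ _ := mul_le_mul' (lintegral_pow_one_sub_abs_le ha k) (volume_halfCube_le m)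

theorem setLIntegral_facetRegion_le (m k : ℕ) {K : Set (EuclideanSpace ℝ (Fin (m + 2)))}
    (hK : Convex ℝ K) (hvol : volume K = 1)
    {q : Fin (m + 2) → EuclideanSpace ℝ (Fin (m + 2))} (hq : ∀ i, q i ∈ K) :
    ∫⁻ x in facetRegion q ∩ K, (1 - volume (convexHull ℝ (insert x (Set.range q)))) ^ k ≤
      ENNReal.ofReal (2 ^ (m + 1) * (m + 2).factorial / (k + 1)) := by
  set T := columnMap (facetColumns q) with hT
  by_cases hdet : LinearMap.det T = 0
  · rw [setLIntegral_measure_zero]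
    · exact zero_le
    · have hsub : facetRegion q ∩ K ⊆ (fun x => q 0 + x) '' (T '' Set.univ) := by
        rintro x ⟨hx, -⟩
        obtain ⟨z, -, rfl⟩ := exists_chart_of_mem_facetRegion hx
        exact ⟨_, ⟨z, trivial, rfl⟩, rfl⟩
      refine measure_mono_null hsub ?_
      rw [Set.image_add_left, measure_preimage_add, Measure.addHaar_image_linearMap, hdet]
      simp
  have hδ : 0 < |LinearMap.det T| := abs_pos.2 hdet
  set a := |LinearMap.det T| / (m + 2).factorial with ha_def
  have ha : 0 < a := by positivity
  let A : Set (EuclideanSpace ℝ (Fin (m + 2))) :=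
    {z | ((∀ i : Fin (m + 1), |z i.succ| ≤ 1) ∧ 0 ≤ ∑ i : Fin (m + 1), z i.succ) ∧
        a * |z 0| ≤ 1}
  have hAm : MeasurableSet A := by
    refine IsClosed.measurableSet ?_
    have h1 : IsClosed {z : EuclideanSpace ℝ (Fin (m + 2)) | ∀ i : Fin (m + 1), |z i.succ| ≤ 1} := by
      simp only [Set.ofPred_forall]
      exact isClosed_iInter fun i => isClosed_le (by fun_prop) continuous_const
    exact (h1.inter (isClosed_le (g := fun x : EuclideanSpace ℝ (Fin (m + 2)) =>
      ∑ i : Fin (m + 1), x i.succ) continuous_const (by fun_prop))).inter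
      (isClosed_le (f := fun x : EuclideanSpace ℝ (Fin (m + 2)) => a * |x 0|) (by fun_prop)
        continuous_const)
  let Φ : EuclideanSpace ℝ (Fin (m + 2)) → EuclideanSpace ℝ (Fin (m + 2)) := fun z => q 0 + T z
  have hlow (z : EuclideanSpace ℝ (Fin (m + 2))) : ENNReal.ofReal (a * |z 0|) ≤
      volume (convexHull ℝ (insert (Φ z) (Set.range q))) := volume_convexHull_insert_facet_ge q z
  have hsub : facetRegion q ∩ K ⊆ Φ '' A := by
    rintro x ⟨hx, hxK⟩
    obtain ⟨z, hz, rfl⟩ := exists_chart_of_mem_facetRegion hx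
    refine ⟨z, ⟨hz, ?_⟩, rfl⟩
    have h1 := (hlow z).trans ((measure_mono (convexHull_min
      (Set.insert_subset hxK (Set.range_subset_iff.2 hq)) hK)).trans_eq hvol)
    exact ENNReal.ofReal_le_one.1 h1
  have hinj : Set.InjOn Φ A := fun x _ y _ hxy =>
    (LinearMap.equivOfDetNeZero T hdet).injective (add_left_cancel hxy)
  refine (lintegral_mono_set hsub).trans ?_
  rw [lintegral_image_eq_lintegral_abs_det_fderiv_mul volume hAm (f := Φ)
    (f' := fun _ => LinearMap.toContinuousLinearMap T)
    (fun x _ => ((LinearMap.toContinuousLinearMap T).hasFDerivWithinAt).const_add _) hinj]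
  calc _ ≤ ∫⁻ z in A, ENNReal.ofReal |LinearMap.det T| * ENNReal.ofReal (1 - a * |z 0|) ^ k := by
        refine lintegral_mono fun z => ?_
        rw [LinearMap.det_toContinuousLinearMap, ENNReal.ofReal_sub _ (by positivity),
          ENNReal.ofReal_one]
        gcongr
        exact hlow z
    _ = ENNReal.ofReal |LinearMap.det T| * ∫⁻ z in A, ENNReal.ofReal (1 - a * |z 0|) ^ k := by
        rw [lintegral_const_mul' _ _ ENNReal.ofReal_ne_top]
    _ ≤ ENNReal.ofReal |LinearMap.det T| * (ENNReal.ofReal (2 / (a * (k + 1))) * 2 ^ m) := by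
        gcongr
        exact setLIntegral_fst_coord_le m k ha
    _ = _ := by
        rw [show (2 : ENNReal) ^ m = ENNReal.ofReal (2 ^ m) by
          rw [ENNReal.ofReal_pow (by norm_num), ENNReal.ofReal_ofNat],
          ← ENNReal.ofReal_mul (by positivity), ← ENNReal.ofReal_mul (by positivity)]
        congr 1
        rw [ha_def]
        field_simp
        ring

theorem exists_mem_facetRegion {d : ℕ} (p : Fin (d + 2) → EuclideanSpace ℝ (Fin (d + 1))) :
    ∃ i, p i ∈ facetRegion fun j => p (i.succAbove j) := by
  let e : EuclideanSpace ℝ (Fin (d + 1)) := EuclideanSpace.single 0 1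
  let u : Option (Fin (d + 2)) → ℝ × EuclideanSpace ℝ (Fin (d + 1)) :=
    fun o => o.elim (0, e) fun i => (1, p i)
  have hu : ¬ LinearIndependent ℝ u := fun h => by
    have := h.fintype_card_le_finrank
    simp at this
    omega
  obtain ⟨g, hg, o, ho⟩ := Fintype.not_linearIndependent_iff.1 hu
  rw [Fintype.sum_option] at hg
  have h1 : ∑ i, g (some i) = 0 := by simpa [u, Prod.fst_sum] using congrArg Prod.fst hg
  have h2 : g none • e + ∑ i, g (some i) • p i = 0 := by
    simpa [u, Prod.snd_sum] using congrArg Prod.snd hg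
  obtain ⟨i, hi⟩ := Finite.exists_max fun i => |g (some i)|
  have hgi : g (some i) ≠ 0 := by
    intro h0
    have hz (j) : g (some j) = 0 := by
      have := hi j
      rw [h0, abs_zero] at this
      exact abs_nonpos_iff.1 this
    have hnone : g none = 0 := by
      have := congrArg (fun x : EuclideanSpace ℝ (Fin (d + 1)) => x 0) h2
      simpa [hz, e] using this
    cases o with
    | none => exact ho hnone
    | some j => exact ho (hz j)
  refine ⟨i, fun j => -g (some (i.succAbove j)) / g (some i), -g none / g (some i),
    fun j => ?_, ?_, ?_⟩
  · rw [abs_div, abs_neg, div_le_one (abs_pos.2 hgi)]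
    exact hi _
  · rw [Fin.sum_univ_succAbove _ i] at h1
    rw [← Finset.sum_div, Finset.sum_neg_distrib, div_eq_one_iff_eq hgi]
    linarith
  · rw [Fin.sum_univ_succAbove _ i] at h2
    apply smul_right_injective _ hgi
    simp only [smul_add, Finset.smul_sum, smul_smul, mul_div_cancel₀ _ hgi, neg_smul,
      Finset.sum_neg_distrib]
    linear_combination (norm := module) h2

theorem IsSigmaCompact.measurableSet {X : Type*} [TopologicalSpace X] [T2Space X]
    [MeasurableSpace X] [BorelSpace X] {s : Set X} (hs : IsSigmaCompact s) : MeasurableSet s := by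
  obtain ⟨K, hK, rfl⟩ := hs
  exact MeasurableSet.iUnion fun n => (hK n).measurableSet

theorem measurableSet_facetRegion {d : ℕ} (i : Fin (d + 2)) :
    MeasurableSet {p : Fin (d + 2) → EuclideanSpace ℝ (Fin (d + 1)) |
      p i ∈ facetRegion fun j => p (i.succAbove j)} := by
  let C : Set ((Fin (d + 1) → ℝ) × ℝ × (Fin (d + 1) → EuclideanSpace ℝ (Fin (d + 1)))) :=
    {y | (∀ j, |y.1 j| ≤ 1) ∧ ∑ j, y.1 j = 1}
  have hC : IsClosed C := by
    have h1 : IsClosed {y : (Fin (d + 1) → ℝ) × ℝ × (Fin (d + 1) →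
        EuclideanSpace ℝ (Fin (d + 1))) | ∀ j, |y.1 j| ≤ 1} := by
      simp only [Set.ofPred_forall]
      exact isClosed_iInter fun i => isClosed_le (by fun_prop) continuous_const
    exact h1.inter (isClosed_eq (f := fun y : (Fin (d + 1) → ℝ) × ℝ × (Fin (d + 1) →
        EuclideanSpace ℝ (Fin (d + 1))) => ∑ j, y.1 j) (by fun_prop) continuous_const)
  let φ (y : (Fin (d + 1) → ℝ) × ℝ × (Fin (d + 1) → EuclideanSpace ℝ (Fin (d + 1)))) :
      Fin (d + 2) → EuclideanSpace ℝ (Fin (d + 1)) :=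
    i.insertNth (∑ j, y.1 j • y.2.2 j + y.2.1 • EuclideanSpace.single 0 1) y.2.2
  have hφ : Continuous φ := by
    refine continuous_pi (i.forall_iff_succAbove.2 ⟨?_, fun j => ?_⟩)
    · simp only [φ, Fin.insertNth_apply_same]
      fun_prop
    · simp only [φ, Fin.insertNth_apply_succAbove]
      fun_prop
  convert ((isSigmaCompact_univ.of_isClosed_subset hC (Set.subset_univ _)).image hφ).measurableSet
    using 1
  ext p
  constructor
  · rintro ⟨b, s, hb, hb1, hx⟩
    refine ⟨(b, s, fun j => p (i.succAbove j)), ⟨hb, hb1⟩, ?_⟩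
    simp only [φ, ← hx]
    exact Fin.insertNth_self_removeNth i p
  · rintro ⟨y, ⟨hb, hb1⟩, rfl⟩
    exact ⟨y.1, y.2.1, hb, hb1, by simp [φ]⟩

theorem mem_interior_convexHull_range_iff {d : ℕ} (p : Fin (d + 1) → EuclideanSpace ℝ (Fin d))
    (x : EuclideanSpace ℝ (Fin d)) :
    x ∈ interior (convexHull ℝ (Set.range p)) ↔ AffineIndependent ℝ p ∧
      ∃ w : Fin (d + 1) → ℝ, (∀ i, 0 < w i) ∧ ∑ i, w i = 1 ∧ ∑ i, w i • p i = x := by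
  constructor
  · intro hx
    have htop := affineSpan_eq_top_of_nonempty_interior ⟨x, hx⟩
    have hind : AffineIndependent ℝ p := by
      rw [affineIndependent_iff_finrank_vectorSpan_eq ℝ p (n := d) (by simp),
        ← direction_affineSpan, htop, AffineSubspace.direction_top, finrank_top]
      simp
    let b : AffineBasis (Fin (d + 1)) ℝ (EuclideanSpace ℝ (Fin d)) := ⟨p, hind, htop⟩
    have hx' : x ∈ interior (convexHull ℝ (Set.range b)) := hx
    rw [b.interior_convexHull] at hx'
    exact ⟨hind, fun i => b.coord i x, hx', b.sum_coord_apply_eq_one x,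
      b.linear_combination_coord_eq_self x⟩
  · rintro ⟨hind, w, hw, hw1, rfl⟩
    let b : AffineBasis (Fin (d + 1)) ℝ (EuclideanSpace ℝ (Fin d)) :=
      ⟨p, hind, hind.affineSpan_eq_top_iff_card_eq_finrank_add_one.2 (by simp)⟩
    change _ ∈ interior (convexHull ℝ (Set.range b))
    rw [b.interior_convexHull]
    intro i
    have := b.coord_apply_combination_of_mem (Finset.mem_univ i) hw1
    rw [Finset.affineCombination_eq_linear_combination _ _ _ hw1] at this
    exact this.symm ▸ hw i

theorem measurableSet_interior_convexHull_range {d : ℕ} :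
    MeasurableSet {y : (Fin (d + 1) → EuclideanSpace ℝ (Fin d)) × EuclideanSpace ℝ (Fin d) |
      y.2 ∈ interior (convexHull ℝ (Set.range y.1))} := by
  let C : Set ((Fin (d + 1) → EuclideanSpace ℝ (Fin d)) × (Fin (d + 1) → ℝ)) :=
    {y | AffineIndependent ℝ y.1 ∧ (∀ i, 0 < y.2 i)} ∩ {y | ∑ i, y.2 i = 1}
  have hC : IsSigmaCompact C := by
    have h0 : IsOpen {y : (Fin (d + 1) → EuclideanSpace ℝ (Fin d)) × (Fin (d + 1) → ℝ) |
        ∀ i, 0 < y.2 i} := by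
      simp only [Set.ofPred_forall]
      exact isOpen_iInter_of_finite fun i => isOpen_lt continuous_const (by fun_prop)
    have h1 : IsOpen {y : (Fin (d + 1) → EuclideanSpace ℝ (Fin d)) × (Fin (d + 1) → ℝ) |
        AffineIndependent ℝ y.1 ∧ (∀ i, 0 < y.2 i)} :=
      (isOpen_setOfPred_affineIndependent.preimage continuous_fst).inter h0
    have h2 : IsClosed {y : (Fin (d + 1) → EuclideanSpace ℝ (Fin d)) × (Fin (d + 1) → ℝ) |
        ∑ i, y.2 i = 1} := isClosed_eq (by fun_prop) continuous_const
    have := (h1.isLocallyClosed.inter h2.isLocallyClosed).locallyCompactSpace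
    exact isSigmaCompact_iff_sigmaCompactSpace.2 inferInstance
  convert (hC.image (f := fun y => (y.1, ∑ i, y.2 i • y.1 i)) (by fun_prop)).measurableSet using 1
  ext ⟨p, x⟩
  simp only [Set.mem_ofPred_eq, mem_interior_convexHull_range_iff]
  constructor
  · rintro ⟨hp, w, hw, hw1, rfl⟩
    exact ⟨(p, w), ⟨⟨hp, hw⟩, hw1⟩, rfl⟩
  · rintro ⟨⟨p', w⟩, ⟨⟨hp, hw⟩, hw1⟩, h⟩
    obtain ⟨rfl, rfl⟩ := Prod.mk.inj h
    exact ⟨hp, w, hw, hw1, rfl⟩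

theorem measurableSet_empty_facetRegion (m : ℕ) (ρ : Type*) [Fintype ρ] (i : Fin (m + 3)) :
    MeasurableSet {y : (Fin (m + 3) → EuclideanSpace ℝ (Fin (m + 2))) ×
        (ρ → EuclideanSpace ℝ (Fin (m + 2))) |
      y.1 i ∈ facetRegion (fun j => y.1 (i.succAbove j)) ∧
        ∀ r, y.2 r ∉ interior (convexHull ℝ (Set.range y.1))} := by
  have h : MeasurableSet {y : (Fin (m + 3) → EuclideanSpace ℝ (Fin (m + 2))) ×
      (ρ → EuclideanSpace ℝ (Fin (m + 2))) |
      ∀ r, y.2 r ∉ interior (convexHull ℝ (Set.range y.1))} := by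
    simp only [Set.ofPred_forall]
    refine MeasurableSet.iInter fun r => MeasurableSet.compl ?_
    exact measurableSet_interior_convexHull_range.preimage
      (measurable_fst.prodMk ((measurable_pi_apply r).comp measurable_snd))
  exact (measurable_fst (measurableSet_facetRegion i)).inter h

theorem prod_measure_empty_facetRegion_le (m : ℕ) {K : Set (EuclideanSpace ℝ (Fin (m + 2)))}
    (hKcomp : IsCompact K) (hK : Convex ℝ K) (hvol : volume K = 1) (ρ : Type*) [Fintype ρ]
    (i : Fin (m + 3)) :
    ((Measure.pi fun _ : Fin (m + 3) => volume.restrict K).prod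
      (Measure.pi fun _ : ρ => volume.restrict K))
      {y | y.1 i ∈ facetRegion (fun j => y.1 (i.succAbove j)) ∧
        ∀ r, y.2 r ∉ interior (convexHull ℝ (Set.range y.1))} ≤
      ENNReal.ofReal (2 ^ (m + 1) * (m + 2).factorial / (Fintype.card ρ + 1)) := by
  classical
  have : IsProbabilityMeasure (volume.restrict K) := ⟨by simpa using hvol⟩
  set ν := Measure.pi fun _ : ρ => volume.restrict K
  set W : Set ((Fin (m + 3) → EuclideanSpace ℝ (Fin (m + 2))) ×
      (ρ → EuclideanSpace ℝ (Fin (m + 2)))) :=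
    {y | y.1 i ∈ facetRegion (fun j => y.1 (i.succAbove j)) ∧
        ∀ r, y.2 r ∉ interior (convexHull ℝ (Set.range y.1))} with hW
  have hWm : MeasurableSet W := measurableSet_empty_facetRegion m ρ i
  let G : (Fin (m + 3) → EuclideanSpace ℝ (Fin (m + 2))) → ENNReal := fun p => ν (Prod.mk p ⁻¹' W)
  have hG : Measurable G := measurable_measure_prodMk_left hWm
  have hmp := measurePreserving_piFinSuccAbove
    (fun _ : Fin (m + 3) => (volume.restrict K : Measure (EuclideanSpace ℝ (Fin (m + 2))))) i
  rw [Measure.prod_apply hWm]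
  change ∫⁻ p, G p ∂_ ≤ _
  rw [← hmp.symm.lintegral_comp_emb (MeasurableEquiv.measurableEmbedding _) G,
    lintegral_prod_symm _ (by fun_prop)]
  have hinner : ∀ᵐ q ∂(Measure.pi fun _ : Fin (m + 2) => volume.restrict K),
      ∫⁻ x, G (i.insertNth x q) ∂volume.restrict K ≤
        ENNReal.ofReal (2 ^ (m + 1) * (m + 2).factorial / (Fintype.card ρ + 1)) := by
    have hqK : ∀ᵐ q ∂(Measure.pi fun _ : Fin (m + 2) => volume.restrict K), ∀ j, q j ∈ K :=
      ae_all_iff.2 fun j =>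
        Measure.tendsto_eval_ae_ae.eventually (ae_restrict_mem hKcomp.measurableSet)
    filter_upwards [hqK] with q hq
    have hRm : MeasurableSet (facetRegion q) := by
      have := (measurableSet_facetRegion i).preimage
        (f := fun x : EuclideanSpace ℝ (Fin (m + 2)) =>
          (i.insertNth x q : Fin (m + 3) → EuclideanSpace ℝ (Fin (m + 2))))
        ((MeasurableEquiv.piFinSuccAbove
          (fun _ => EuclideanSpace ℝ (Fin (m + 2))) i).symm.measurable.comp
          (measurable_id.prodMk measurable_const))
      simpa using this
    refine le_trans ?_ (setLIntegral_facetRegion_le m (Fintype.card ρ) hK hvol hq)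
    rw [← Measure.restrict_restrict hRm, ← lintegral_indicator hRm]
    refine setLIntegral_mono' hKcomp.measurableSet fun x hx => ?_
    by_cases hxR : x ∈ facetRegion q
    · rw [Set.indicator_of_mem hxR]
      set C := convexHull ℝ (insert x (Set.range q)) with hC
      have hCK : C ⊆ K := convexHull_min (Set.insert_subset hx (Set.range_subset_iff.2 hq)) hK
      have hsec : Prod.mk (i.insertNth x q : Fin (m + 3) → EuclideanSpace ℝ (Fin (m + 2))) ⁻¹' W =
          Set.univ.pi fun _ : ρ => (interior C)ᶜ := by
        ext y
        simp [hW, hxR, hC]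
        rfl
      have hint : volume (interior C) = volume C := by
        refine measure_congr (interior_ae_eq_of_null_frontier ?_)
        exact (convex_convexHull ℝ _).addHaar_frontier volume
      simp only [G, hsec, ν, Measure.pi_pi, Finset.prod_const, Finset.card_univ]
      rw [prob_compl_eq_one_sub isOpen_interior.measurableSet,
        Measure.restrict_apply isOpen_interior.measurableSet,
        Set.inter_eq_left.2 (interior_subset.trans hCK), hint]
    · have hsec : Prod.mk (i.insertNth x q : Fin (m + 3) → EuclideanSpace ℝ (Fin (m + 2))) ⁻¹' W =
          ∅ := by
        ext y
        simp [hW, hxR]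
      simp [G, hsec]
  calc _ ≤ ∫⁻ _, ENNReal.ofReal (2 ^ (m + 1) * (m + 2).factorial / (Fintype.card ρ + 1))
        ∂(Measure.pi fun _ : Fin (m + 2) => volume.restrict K) := lintegral_mono_ae hinner
    _ = _ := by simp

theorem pi_measure_empty_facetRegion_le (m n : ℕ) {K : Set (EuclideanSpace ℝ (Fin (m + 2)))}
    (hKcomp : IsCompact K) (hK : Convex ℝ K) (hvol : volume K = 1)
    (f : Fin (m + 3) ↪ Fin n) (i : Fin (m + 3)) :
    (Measure.pi fun _ : Fin n => volume.restrict K)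
      {S | S (f i) ∈ facetRegion (fun j => S (f (i.succAbove j))) ∧
        ∀ r, S r ∉ interior (convexHull ℝ (Set.range fun j => S (f j)))} ≤
      ENNReal.ofReal (2 ^ (m + 1) * (m + 2).factorial / ((n - (m + 3) : ℕ) + 1)) := by
  classical
  have : IsProbabilityMeasure (volume.restrict K) := ⟨by simpa using hvol⟩
  let ρ := {r : Fin n // ¬ ∃ j, f j = r}
  let e : Fin (m + 3) ≃ {r : Fin n // ∃ j, f j = r} := Equiv.ofInjective f f.injective
  have hcard : Fintype.card ρ = n - (m + 3) := by
    rw [Fintype.card_subtype_compl, Fintype.card_fin, ← Fintype.card_congr e, Fintype.card_fin]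
  have h1 := measurePreserving_piEquivPiSubtypeProd
    (fun _ : Fin n => (volume.restrict K : Measure (EuclideanSpace ℝ (Fin (m + 2)))))
    (fun r => ∃ j, f j = r)
  have h2 := (measurePreserving_piCongrLeft (fun _ : {r : Fin n // ∃ j, f j = r} =>
    (volume.restrict K : Measure (EuclideanSpace ℝ (Fin (m + 2))))) e).symm
  have h3 := (h2.prod (MeasurePreserving.id
    (Measure.pi fun _ : ρ => (volume.restrict K : Measure (EuclideanSpace ℝ (Fin (m + 2))))))).comp
      h1
  have hle := prod_measure_empty_facetRegion_le m hKcomp hK hvol ρ i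
  rw [hcard, ← h3.measure_preimage (measurableSet_empty_facetRegion m ρ i).nullMeasurableSet] at hle
  refine (measure_mono ?_).trans hle
  rintro S ⟨hS, hempty⟩
  exact ⟨hS, fun r => hempty r⟩

theorem exists_empty_facetRegion {d n : ℕ} (S : Fin n → EuclideanSpace ℝ (Fin (d + 1)))
    (H : Finset (EuclideanSpace ℝ (Fin (d + 1)))) (hHS : (H : Set _) ⊆ Set.range S)
    (hcard : H.card = d + 2)
    (hempty : interior (convexHull ℝ (H : Set (EuclideanSpace ℝ (Fin (d + 1))))) ∩ Set.range S = ∅) :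
    ∃ (A : {A : Finset (Fin n) // A.card = d + 2}) (i : Fin (d + 2)),
      H = A.1.image S ∧
      S (A.1.orderEmbOfFin A.2 i) ∈
        facetRegion (fun j => S (A.1.orderEmbOfFin A.2 (i.succAbove j))) ∧
      ∀ r, S r ∉ interior (convexHull ℝ (Set.range fun j => S (A.1.orderEmbOfFin A.2 j))) := by
  classical
  obtain ⟨A, -, hinj, rfl⟩ := Finset.exists_subset_injOn_image_eq_of_surjOn (f := S) Set.univ H
    (fun x hx => by simpa using hHS hx)
  have hA : A.card = d + 2 := by rw [← hcard, Finset.card_image_of_injOn hinj]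
  obtain ⟨i, hi⟩ := exists_mem_facetRegion fun j => S (A.orderEmbOfFin hA j)
  refine ⟨⟨A, hA⟩, i, by congr!, hi, fun r hr => ?_⟩
  have hrange : (Set.range fun j => S (A.orderEmbOfFin hA j)) = (A.image S : Finset _) := by
    rw [Finset.coe_image, ← Finset.range_orderEmbOfFin A hA, ← Set.range_comp]
    rfl
  rw [hrange] at hr
  exact hempty.subset ⟨hr, r, rfl⟩

/-- Let `K ⊆ ℝ^d` (`d ≥ 2`) be a convex body of volume `1` and let `S` be `n` points chosen
independently and uniformly at random from `K`. The expected number of `(d+1)`-holes (empty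
simplices) in `S` is at most `2^{d-1} · d! · binom(n,d)`. -/
theorem expected_empty_simplices_le
    (d n : ℕ) (hd : 2 ≤ d) (K : Set (EuclideanSpace ℝ (Fin d)))
    (hKcomp : IsCompact K) (hKconv : Convex ℝ K) (hKint : (interior K).Nonempty)
    (hKvol : volume K = 1) :
    (∫ S : Fin n → EuclideanSpace ℝ (Fin d),
      (Set.ncard {H : Finset (EuclideanSpace ℝ (Fin d)) |
        (H : Set (EuclideanSpace ℝ (Fin d))) ⊆ Set.range S ∧ H.card = d + 1 ∧
        (∀ p ∈ H, p ∉ convexHull ℝ ((H : Set (EuclideanSpace ℝ (Fin d))) \ {p})) ∧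
        interior (convexHull ℝ (H : Set (EuclideanSpace ℝ (Fin d)))) ∩ Set.range S = ∅} : ℝ)
      ∂(Measure.pi fun _ : Fin n => volume.restrict K))
    ≤ 2 ^ (d - 1) * (Nat.factorial d : ℝ) * (n.choose d : ℝ) := by
  classical
  obtain ⟨m, rfl⟩ := Nat.exists_eq_add_of_le' hd
  set N : (Fin n → EuclideanSpace ℝ (Fin (m + 2))) → ℝ := fun S =>
    (Set.ncard {H : Finset (EuclideanSpace ℝ (Fin (m + 2))) |
        (H : Set (EuclideanSpace ℝ (Fin (m + 2)))) ⊆ Set.range S ∧ H.card = m + 2 + 1 ∧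
        (∀ p ∈ H, p ∉ convexHull ℝ ((H : Set (EuclideanSpace ℝ (Fin (m + 2)))) \ {p})) ∧
        interior (convexHull ℝ (H : Set (EuclideanSpace ℝ (Fin (m + 2))))) ∩ Set.range S = ∅} : ℝ)
    with hN
  set μ := Measure.pi fun _ : Fin n =>
    (volume.restrict K : Measure (EuclideanSpace ℝ (Fin (m + 2))))
  change ∫ S, N S ∂μ ≤ _
  by_cases hint : Integrable N μ
  swap
  · rw [integral_undef hint]
    positivity
  let I := {A : Finset (Fin n) // A.card = m + 3} × Fin (m + 3)
  let V (t : I) : Set (Fin n → EuclideanSpace ℝ (Fin (m + 2))) :=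
    {S | S (t.1.1.orderEmbOfFin t.1.2 t.2) ∈
        facetRegion (fun j => S (t.1.1.orderEmbOfFin t.1.2 (t.2.succAbove j))) ∧
      ∀ r, S r ∉ interior (convexHull ℝ (Set.range fun j => S (t.1.1.orderEmbOfFin t.1.2 j)))}
  have hcount (S) : ENNReal.ofReal (N S) ≤
      ∑ t : I, (toMeasurable μ (V t)).indicator (fun _ => (1 : ENNReal)) S := by
    have hle : N S ≤ ((Finset.univ.filter fun t : I => S ∈ V t).card : ℝ) := by
      rw [hN, Nat.cast_le]
      refine (Set.ncard_le_ncard (t := ((Finset.univ.filter fun t : I => S ∈ V t).image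
        fun t => t.1.1.image S : Finset (Finset _))) ?_ (Finset.finite_toSet _)).trans ?_
      · rintro H ⟨hHS, hcard, -, hempty⟩
        obtain ⟨A, i, hH, hV⟩ := exists_empty_facetRegion S H hHS hcard hempty
        simp only [Finset.coe_image, Set.mem_image, Finset.mem_coe, Finset.mem_filter,
          Finset.mem_univ, true_and]
        refine ⟨(A, i), hV, ?_⟩
        rw [hH]
      · rw [Set.ncard_coe_finset]
        exact Finset.card_image_le
    refine (ENNReal.ofReal_le_ofReal hle).trans ?_
    rw [ENNReal.ofReal_natCast, Finset.card_filter, Nat.cast_sum]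
    refine Finset.sum_le_sum fun t _ => ?_
    by_cases ht : S ∈ V t
    · simp [ht, subset_toMeasurable μ (V t) ht]
    · simp [ht]
  have hbound : ∫⁻ S, ENNReal.ofReal (N S) ∂μ ≤ ENNReal.ofReal
      (2 ^ (m + 1) * (m + 2).factorial * n.choose (m + 2)) := by
    calc _ ≤ ∫⁻ S, ∑ t : I, (toMeasurable μ (V t)).indicator (fun _ => (1 : ENNReal)) S ∂μ :=
          lintegral_mono hcount
      _ = ∑ t : I, μ (V t) := by
          rw [lintegral_finsetSum _ fun t _ =>
            measurable_const.indicator (measurableSet_toMeasurable _ _)]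
          simp
      _ ≤ ∑ _t : I, ENNReal.ofReal
            (2 ^ (m + 1) * (m + 2).factorial / ((n - (m + 3) : ℕ) + 1)) :=
          Finset.sum_le_sum fun t _ => pi_measure_empty_facetRegion_le m n hKcomp hKconv hKvol
            (t.1.1.orderEmbOfFin t.1.2).toEmbedding t.2
      _ = ENNReal.ofReal ((n.choose (m + 3) * (m + 3) : ℕ) *
            (2 ^ (m + 1) * (m + 2).factorial / ((n - (m + 3) : ℕ) + 1))) := by
          rw [ENNReal.ofReal_mul (by positivity), ENNReal.ofReal_natCast, Finset.sum_const,
            nsmul_eq_mul, Finset.card_univ, Fintype.card_prod, Fintype.card_finset_len,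
            Fintype.card_fin, Fintype.card_fin]
      _ ≤ _ := by
          refine ENNReal.ofReal_le_ofReal ?_
          rcases lt_or_ge n (m + 3) with hlt | hge
          · rw [Nat.choose_eq_zero_of_lt hlt]
            simp only [zero_mul, Nat.cast_zero]
            positivity
          · have hcast : ((n - (m + 3) : ℕ) + 1 : ℝ) = (n - (m + 2) : ℕ) := by
              rw [show n - (m + 2) = n - (m + 3) + 1 by omega]
              push_cast
              rfl
            have hpos : (0 : ℝ) < (n - (m + 2) : ℕ) := by
              rw [Nat.cast_pos]
              omega
            rw [Nat.choose_succ_right_eq n (m + 2), hcast, Nat.cast_mul]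
            apply le_of_eq
            field_simp
  rw [integral_eq_lintegral_of_nonneg_ae (.of_forall fun S => Nat.cast_nonneg _)
    hint.aestronglyMeasurable]
  exact ENNReal.toReal_le_of_le_ofReal (by positivity) hbound
end

section
/- Let d ≥ 2 and k ≥ d+1 be integers, let K ⊆ ℝ^d be a convex body with λ_d(K) = 1, and let S be n ≥ k i.i.d. uniform points in K. Then the expected number of k-holes in S is at most 2^{d−1} · (2 d^{2d−1} binom(k, ⌊d/2⌋))^{k−d−1} · n(n−1)⋯(n−k+2) / ((k−d−1)! · (n−k+1)^{k−d−1}). -/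
open MeasureTheory

/-- Homogeneous coordinates `(1, x)` of a point `x`. -/
noncomputable def homCoord {d : ℕ} (x : EuclideanSpace ℝ (Fin d)) : Fin (d + 1) → ℝ :=
  Fin.cons 1 x

/-- The matrix whose rows are the homogeneous coordinates of the points of `u`. -/
noncomputable def homMatrix {d : ℕ} (u : Fin (d + 1) → EuclideanSpace ℝ (Fin d)) :
    Matrix (Fin (d + 1)) (Fin (d + 1)) ℝ :=
  Matrix.of fun i => homCoord (u i)

/-- The signed volume of the simplex with vertices `u`, multiplied by `d!`. -/
noncomputable def simplexDet {d : ℕ} (u : Fin (d + 1) → EuclideanSpace ℝ (Fin d)) : ℝ :=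
  (homMatrix u).det

/-- The homogeneous coordinates of the direction `(1, …, 1)`. -/
def homDir (d : ℕ) : Fin (d + 1) → ℝ := Fin.cons 0 1

/-- The signed volume, multiplied by `(d - 1)!` and a constant, of the projection along
`(1, …, 1)` of the facet opposite to the vertex `u j`. -/
noncomputable def facetDet {d : ℕ} (u : Fin (d + 1) → EuclideanSpace ℝ (Fin d))
    (j : Fin (d + 1)) : ℝ :=
  ((homMatrix u).updateRow j (homDir d)).det

theorem det_eq_det_sub_mul {R : Type*} [CommRing R] {d : ℕ}
    (N : Matrix (Fin (d + 1)) (Fin (d + 1)) R) (h : N 0 0 = 1) :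
    N.det = (Matrix.of fun i j : Fin d => N i.succ j.succ - N i.succ 0 * N 0 j.succ).det := by
  let B : Matrix (Fin (d + 1)) (Fin (d + 1)) R :=
    Matrix.of fun i j =>
      N i j - (Fin.cons 0 (fun i : Fin d => N i.succ 0) : Fin (d + 1) → R) i * N 0 j
  have hB : N.det = B.det := by
    refine Matrix.det_eq_of_forall_row_eq_smul_add_const
      (Fin.cons 0 (fun i : Fin d => N i.succ 0)) 0 rfl ?_
    intro i j
    simp [B]
  rw [hB, Matrix.det_succ_column_zero, Fin.sum_univ_succ]
  have h0 : ∀ i : Fin d, B i.succ 0 = 0 := by intro i; simp [B, h]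
  simp only [h0]
  simp [B, h]
  rfl

theorem simplexDet_eq {d : ℕ} (u : Fin (d + 1) → EuclideanSpace ℝ (Fin d)) :
    simplexDet u = (Matrix.of fun i j : Fin d => u i.succ j - u 0 j).det := by
  rw [simplexDet, det_eq_det_sub_mul _ (by simp [homMatrix, homCoord])]
  simp [homMatrix, homCoord]

theorem lintegral_comp_affine {d : ℕ} (x₀ : EuclideanSpace ℝ (Fin d))
    (w : Fin d → EuclideanSpace ℝ (Fin d)) (hw : (Matrix.of fun i j => w i j).det ≠ 0)
    {f : EuclideanSpace ℝ (Fin d) → ENNReal} (hf : Measurable f) :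
    ∫⁻ x, f x = ENNReal.ofReal |(Matrix.of fun i j => w i j).det| *
      ∫⁻ y : Fin d → ℝ, f (x₀ + ∑ i, y i • w i) := by
  set M := (Matrix.of fun i j => w i j).transpose with hM
  have hdet : M.det = (Matrix.of fun i j => w i j).det := Matrix.det_transpose _
  rw [← hdet] at hw ⊢
  have h1 : ∫⁻ x, f x = ∫⁻ z : Fin d → ℝ, f (x₀ + WithLp.toLp 2 z) := by
    rw [← lintegral_add_left_eq_self _ x₀,
      ← (PiLp.volume_preserving_toLp (Fin d)).lintegral_comp (by fun_prop)]
  have h2 : ∀ y : Fin d → ℝ, x₀ + ∑ i, y i • w i = x₀ + WithLp.toLp 2 (Matrix.toLin' M y) := by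
    intro y
    congr 1
    ext j
    simp [hM, Matrix.mulVec, dotProduct, mul_comm]
  have hg : Measurable fun z : Fin d → ℝ => f (x₀ + WithLp.toLp 2 z) := by fun_prop
  have h3 := congrArg (fun ν => ∫⁻ z, f (x₀ + WithLp.toLp 2 z) ∂ν)
    (Real.map_matrix_volume_pi_eq_smul_volume_pi hw)
  rw [lintegral_map hg (LinearMap.continuous_of_finiteDimensional _).measurable,
    lintegral_smul_measure] at h3
  simp_rw [h2]
  rw [h3, h1, smul_eq_mul, ← mul_assoc, ← ENNReal.ofReal_mul (abs_nonneg _), ← abs_mul,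
    mul_inv_cancel₀ hw]
  simp

theorem homCoord_affine {d : ℕ} (u : Fin (d + 1) → EuclideanSpace ℝ (Fin d)) (y : Fin d → ℝ) :
    homCoord (u 0 + ∑ i, y i • (u i.succ - u 0)) =
      ∑ k, (Fin.cons (1 - ∑ i, y i) y : Fin (d + 1) → ℝ) k • homMatrix u k := by
  ext j
  rw [Fin.sum_univ_succ]
  refine Fin.cases ?_ (fun j => ?_) j
  · simp [homMatrix, homCoord]
  · simp [homMatrix, homCoord, mul_sub, Finset.sum_sub_distrib, sub_mul, Finset.sum_mul]
    ring

theorem homMatrix_update {d : ℕ} (u : Fin (d + 1) → EuclideanSpace ℝ (Fin d)) (i : Fin (d + 1))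
    (x : EuclideanSpace ℝ (Fin d)) :
    homMatrix (Function.update u i x) = (homMatrix u).updateRow i (homCoord x) := by
  ext a b
  rcases eq_or_ne a i with rfl | h
  · simp [homMatrix]
  · simp [homMatrix, h]

theorem simplexDet_update_affine {d : ℕ} (u : Fin (d + 1) → EuclideanSpace ℝ (Fin d))
    (y : Fin d → ℝ) (i : Fin (d + 1)) :
    simplexDet (Function.update u i (u 0 + ∑ i, y i • (u i.succ - u 0))) =
      (Fin.cons (1 - ∑ i, y i) y : Fin (d + 1) → ℝ) i * simplexDet u := by
  rw [simplexDet, homMatrix_update, homCoord_affine, Matrix.det_updateRow_sum, smul_eq_mul,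
    simplexDet]

theorem lintegral_comp_simplex {d : ℕ} (u : Fin (d + 1) → EuclideanSpace ℝ (Fin d))
    (hu : simplexDet u ≠ 0) {f : EuclideanSpace ℝ (Fin d) → ENNReal} (hf : Measurable f) :
    ∫⁻ x, f x = ENNReal.ofReal |simplexDet u| *
      ∫⁻ y : Fin d → ℝ, f (u 0 + ∑ i, y i • (u i.succ - u 0)) := by
  rw [simplexDet_eq] at hu ⊢
  exact lintegral_comp_affine (u 0) (fun i => u i.succ - u 0) hu hf

theorem homMatrix_comp_perm {d : ℕ} (u : Fin (d + 1) → EuclideanSpace ℝ (Fin d))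
    (τ : Equiv.Perm (Fin (d + 1))) : homMatrix (u ∘ τ) = (homMatrix u).submatrix τ id := rfl

theorem abs_simplexDet_comp_perm {d : ℕ} (u : Fin (d + 1) → EuclideanSpace ℝ (Fin d))
    (τ : Equiv.Perm (Fin (d + 1))) : |simplexDet (u ∘ τ)| = |simplexDet u| := by
  rw [simplexDet, homMatrix_comp_perm, Matrix.det_permute, abs_mul, simplexDet]
  rcases Int.units_eq_one_or (Equiv.Perm.sign τ) with h | h <;> simp [h]

theorem abs_facetDet_comp_perm {d : ℕ} (u : Fin (d + 1) → EuclideanSpace ℝ (Fin d))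
    (τ : Equiv.Perm (Fin (d + 1))) (j : Fin (d + 1)) :
    |facetDet (u ∘ τ) j| = |facetDet u (τ j)| := by
  have : (homMatrix (u ∘ τ)).updateRow j (homDir d) =
      ((homMatrix u).updateRow (τ j) (homDir d)).submatrix τ id := by
    ext a b
    rcases eq_or_ne a j with rfl | h
    · simp
    · simp [h, homMatrix_comp_perm]
  rw [facetDet, this, Matrix.det_permute, abs_mul, facetDet]
  rcases Int.units_eq_one_or (Equiv.Perm.sign τ) with h | h <;> simp [h]

theorem facetDet_ne_zero {d : ℕ} [NeZero d] (u : Fin (d + 1) → EuclideanSpace ℝ (Fin d))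
    (hu : simplexDet u ≠ 0) (h : ∀ j, |facetDet u j| ≤ |facetDet u 0|) : facetDet u 0 ≠ 0 := by
  intro h0
  have hz : ∀ j, facetDet u j = 0 := fun j => by simpa [h0] using h j
  have hc : Matrix.cramer (homMatrix u).transpose (homDir d) = 0 := by
    ext j
    rw [Matrix.cramer_transpose_apply]
    exact hz j
  have := Matrix.mulVec_cramer (homMatrix u).transpose (homDir d)
  rw [hc, Matrix.mulVec_zero, Matrix.det_transpose] at this
  have h1 := congrFun this (Fin.succ 0)
  simp only [homDir, Pi.zero_apply, Pi.smul_apply, Fin.cons_succ, Pi.one_apply, smul_eq_mul,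
    mul_one] at h1
  exact hu h1.symm

theorem continuous_homMatrix {d : ℕ} :
    Continuous (homMatrix : (Fin (d + 1) → EuclideanSpace ℝ (Fin d)) → _) := by
  refine continuous_matrix fun i j => ?_
  refine Fin.cases ?_ (fun j => ?_) j
  · simp only [homMatrix, homCoord, Matrix.of_apply, Fin.cons_zero]; fun_prop
  · simp only [homMatrix, homCoord, Matrix.of_apply, Fin.cons_succ]; fun_prop

theorem continuous_simplexDet {d : ℕ} :
    Continuous (simplexDet : (Fin (d + 1) → EuclideanSpace ℝ (Fin d)) → ℝ) :=
  continuous_homMatrix.matrix_det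

theorem continuous_facetDet {d : ℕ} (j : Fin (d + 1)) :
    Continuous fun u : Fin (d + 1) → EuclideanSpace ℝ (Fin d) => facetDet u j :=
  (continuous_homMatrix.matrix_updateRow j continuous_const).matrix_det

theorem lintegral_pi_fin_succ {α : Type*} [MeasurableSpace α] (μ : Measure α) [SigmaFinite μ]
    (d : ℕ) {f : (Fin (d + 1) → α) → ENNReal} (hf : Measurable f) :
    ∫⁻ u, f u ∂(Measure.pi fun _ => μ) =
      ∫⁻ x, ∫⁻ q, f (Fin.cons x q) ∂(Measure.pi fun _ => μ) ∂μ := by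
  have h := (measurePreserving_piFinSuccAbove (fun _ : Fin (d + 1) => μ) 0).symm
  rw [← h.lintegral_comp hf]
  refine (lintegral_prod _ (hf.comp (MeasurableEquiv.measurable _)).aemeasurable).trans ?_
  simp [MeasurableEquiv.piFinSuccAbove, Fin.insertNthEquiv]

theorem lintegral_pi_fin_succ_symm {α : Type*} [MeasurableSpace α] (μ : Measure α) [SigmaFinite μ]
    (d : ℕ) {f : (Fin (d + 1) → α) → ENNReal} (hf : Measurable f) :
    ∫⁻ u, f u ∂(Measure.pi fun _ => μ) =
      ∫⁻ q, ∫⁻ x, f (Fin.cons x q) ∂μ ∂(Measure.pi fun _ => μ) := by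
  have h := (measurePreserving_piFinSuccAbove (fun _ : Fin (d + 1) => μ) 0).symm
  rw [← h.lintegral_comp hf]
  refine (lintegral_prod_symm _ (hf.comp (MeasurableEquiv.measurable _)).aemeasurable).trans ?_
  simp [MeasurableEquiv.piFinSuccAbove, Fin.insertNthEquiv]

theorem measurableSet_openSimplex (d : ℕ) (s : ℝ) :
    MeasurableSet {y : Fin d → ℝ | (∀ i, 0 < y i) ∧ ∑ i, y i < s} := by
  have : {y : Fin d → ℝ | (∀ i, 0 < y i) ∧ ∑ i, y i < s} =
      (⋂ i, {y : Fin d → ℝ | 0 < y i}) ∩ {y | ∑ i, y i < s} := by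
    ext y; simp
  rw [this]
  exact (MeasurableSet.iInter fun i => measurableSet_lt (by fun_prop) (by fun_prop)).inter
    (measurableSet_lt (by fun_prop) (by fun_prop))

theorem le_volume_openSimplex (d : ℕ) {s : ℝ} (hs : 0 < s) :
    ENNReal.ofReal (s ^ d / d.factorial) ≤
      volume {y : Fin d → ℝ | (∀ i, 0 < y i) ∧ ∑ i, y i < s} := by
  induction d generalizing s with
  | zero => simp [hs, volume_pi]
  | succ d ih =>
    have hm := measurableSet_openSimplex (d + 1) s
    rw [← lintegral_indicator_one hm, volume_pi,
      lintegral_pi_fin_succ volume d (measurable_one.indicator hm)]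
    calc ENNReal.ofReal (s ^ (d + 1) / (d + 1).factorial)
        = ∫⁻ t in Set.Ioo 0 s, ENNReal.ofReal ((s - t) ^ d / d.factorial) := by
          rw [← ofReal_integral_eq_lintegral_ofReal, ← integral_Ioc_eq_integral_Ioo,
            ← intervalIntegral.integral_of_le hs.le, intervalIntegral.integral_div,
            intervalIntegral.integral_comp_sub_left (fun t => t ^ d) s, integral_pow,
            Nat.factorial_succ]
          · push_cast
            simp
            congr 1
            field_simp
          · exact (Continuous.integrableOn_Icc (by fun_prop)).mono_set Set.Ioo_subset_Icc_self
          · filter_upwards [ae_restrict_mem measurableSet_Ioo] with t ht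
            have := sub_nonneg.2 ht.2.le
            positivity
      _ ≤ ∫⁻ t in Set.Ioo 0 s, ∫⁻ q : Fin d → ℝ,
            {y : Fin (d + 1) → ℝ | (∀ i, 0 < y i) ∧ ∑ i, y i < s}.indicator 1 (Fin.cons t q) := by
          refine setLIntegral_mono' measurableSet_Ioo fun t ht => ?_
          refine (ih (sub_pos.2 ht.2)).trans ?_
          rw [← lintegral_indicator_one (measurableSet_openSimplex d (s - t))]
          refine lintegral_mono fun q => ?_
          by_cases h : q ∈ {y : Fin d → ℝ | (∀ i, 0 < y i) ∧ ∑ i, y i < s - t}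
          swap
          · rw [Set.indicator_of_notMem h]
            exact zero_le
          obtain ⟨hq, hq'⟩ := id h
          have : (Fin.cons t q : Fin (d + 1) → ℝ) ∈
              {y : Fin (d + 1) → ℝ | (∀ i, 0 < y i) ∧ ∑ i, y i < s} := by
            refine ⟨Fin.cases ht.1 hq, ?_⟩
            rw [Fin.sum_univ_succ]
            simp only [Fin.cons_zero, Fin.cons_succ]
            linarith
          rw [Set.indicator_of_mem this, Set.indicator_of_mem h]
          rfl
      _ ≤ _ := setLIntegral_le_lintegral _ _

theorem measurableSet_cube_half (d : ℕ) :
    MeasurableSet {y : Fin d → ℝ | (∀ i, |y i| ≤ 1) ∧ 0 ≤ ∑ i, y i} := by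
  have : {y : Fin d → ℝ | (∀ i, |y i| ≤ 1) ∧ 0 ≤ ∑ i, y i} =
      (⋂ i, {y : Fin d → ℝ | |y i| ≤ 1}) ∩ {y | 0 ≤ ∑ i, y i} := by
    ext y; simp
  rw [this]
  exact (MeasurableSet.iInter fun i => measurableSet_le (by fun_prop) (by fun_prop)).inter
    (measurableSet_le (by fun_prop) (by fun_prop))

theorem volume_cube_half (d : ℕ) [NeZero d] :
    volume {y : Fin d → ℝ | (∀ i, |y i| ≤ 1) ∧ 0 ≤ ∑ i, y i} ≤ ENNReal.ofReal (2 ^ (d - 1)) := by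
  set A := {y : Fin d → ℝ | (∀ i, |y i| ≤ 1) ∧ 0 ≤ ∑ i, y i} with hA
  have hAm : MeasurableSet A := measurableSet_cube_half d
  have hneg : volume (-A) = volume A := Measure.measure_neg volume A
  let φ : (Fin d → ℝ) →ₗ[ℝ] ℝ := ∑ i, LinearMap.proj i
  have hφ : ∀ y, φ y = ∑ i, y i := by intro y; simp [φ]
  have hnull : volume ((LinearMap.ker φ : Submodule ℝ (Fin d → ℝ)) : Set (Fin d → ℝ)) = 0 := by
    apply Measure.addHaar_submodule
    intro h
    have : φ (Pi.single 0 1) = 0 := by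
      rw [← LinearMap.mem_ker, h]; trivial
    rw [hφ] at this
    simp at this
  have hinter : volume (A ∩ -A) = 0 := by
    refine measure_mono_null ?_ hnull
    rintro y ⟨⟨-, h1⟩, -, h2⟩
    simp only [Pi.neg_apply, Finset.sum_neg_distrib] at h2
    change φ y = 0
    rw [hφ]
    linarith
  have hunion : A ∪ -A ⊆ Set.Icc (fun _ => -1) (fun _ => 1) := by
    rintro y (⟨h, -⟩ | ⟨h, -⟩)
    · exact ⟨fun i => (abs_le.1 (h i)).1, fun i => (abs_le.1 (h i)).2⟩
    · refine ⟨fun i => (abs_le.1 ((abs_neg (y i)) ▸ h i)).1,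
        fun i => (abs_le.1 ((abs_neg (y i)) ▸ h i)).2⟩
  have hsum : volume A + volume A ≤ ENNReal.ofReal (2 ^ d) := by
    have := measure_union_add_inter (μ := volume) A hAm.neg
    rw [hinter, add_zero, hneg] at this
    rw [← this]
    refine (measure_mono hunion).trans ?_
    rw [Real.volume_Icc_pi]
    norm_num
  obtain ⟨e, rfl⟩ : ∃ e, d = e + 1 := Nat.exists_eq_succ_of_ne_zero (NeZero.ne d)
  rw [← two_mul, pow_succ', ENNReal.ofReal_mul (by norm_num), ENNReal.ofReal_ofNat] at hsum
  exact (ENNReal.mul_le_mul_iff_right (by norm_num) (by norm_num)).1 hsum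

theorem lintegral_pow_mul_one_sub_pow (m r : ℕ) :
    ∫⁻ t in Set.Ioo (0 : ℝ) 1, ENNReal.ofReal (t ^ m * (1 - t) ^ r) =
      ENNReal.ofReal (m.factorial * r.factorial / (m + r + 1).factorial) := by
  have key : ∀ m r : ℕ, ∫ t in (0 : ℝ)..1, t ^ m * (1 - t) ^ r =
      m.factorial * r.factorial / (m + r + 1).factorial := by
    intro m
    induction m with
    | zero =>
      intro r
      simp only [pow_zero, one_mul]
      rw [intervalIntegral.integral_comp_sub_left (fun t => t ^ r) 1]
      simp only [sub_self, sub_zero, integral_pow]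
      rw [zero_add, Nat.factorial_succ]
      push_cast
      simp
      field_simp
    | succ m ih =>
      intro r
      have hd : ∀ t : ℝ,
          HasDerivAt (fun t : ℝ => -(1 - t) ^ (r + 1) / (r + 1)) ((1 - t) ^ r) t := by
        intro t
        have := ((((hasDerivAt_id t).const_sub 1).pow (r + 1)).neg).div_const ((r : ℝ) + 1)
        refine this.congr_deriv ?_
        simp
        field_simp
      rw [intervalIntegral.integral_mul_deriv_eq_deriv_mul (u := fun t => t ^ (m + 1))
        (u' := fun t => ((m : ℝ) + 1) * t ^ m)
        (v := fun t : ℝ => -(1 - t) ^ (r + 1) / (r + 1))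
        (fun t _ => by simpa using hasDerivAt_pow (m + 1) t) (fun t _ => hd t)
        (Continuous.intervalIntegrable (by fun_prop) _ _)
        (Continuous.intervalIntegrable (by fun_prop) _ _)]
      have : ∀ t : ℝ, ((m : ℝ) + 1) * t ^ m * (-(1 - t) ^ (r + 1) / (r + 1)) =
          -((m + 1) / (r + 1)) * (t ^ m * (1 - t) ^ (r + 1)) := by intro t; ring
      simp only [this]
      rw [intervalIntegral.integral_const_mul, ih, Nat.factorial_succ m, Nat.factorial_succ r,
        show m + (r + 1) + 1 = m + 1 + r + 1 by ring]
      push_cast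
      simp
      field_simp
  rw [← key, intervalIntegral.integral_of_le zero_le_one, integral_Ioc_eq_integral_Ioo,
    ofReal_integral_eq_lintegral_ofReal]
  · exact (Continuous.integrableOn_Icc (by fun_prop)).mono_set Set.Ioo_subset_Icc_self
  · filter_upwards [ae_restrict_mem measurableSet_Ioo] with t ht
    have := ht.1.le
    have := sub_nonneg.2 ht.2.le
    positivity

/-- The set of points whose barycentric coordinates with respect to `u` are all positive. -/
def openSimplex {d : ℕ} (u : Fin (d + 1) → EuclideanSpace ℝ (Fin d)) :
    Set (EuclideanSpace ℝ (Fin d)) :=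
  {x | ∀ i, 0 < simplexDet (Function.update u i x) * simplexDet u}

/-- The set of points whose barycentric coordinates with respect to `u` are at most `1` in
absolute value. -/
def wideSimplex {d : ℕ} (u : Fin (d + 1) → EuclideanSpace ℝ (Fin d)) :
    Set (EuclideanSpace ℝ (Fin d)) :=
  {x | ∀ i, |simplexDet (Function.update u i x)| ≤ |simplexDet u|}

theorem isOpen_openSimplex {d : ℕ} (u : Fin (d + 1) → EuclideanSpace ℝ (Fin d)) :
    IsOpen (openSimplex u) := by
  have : openSimplex u = ⋂ i, {x | 0 < simplexDet (Function.update u i x) * simplexDet u} := by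
    ext x; simp [openSimplex]
  rw [this]
  refine isOpen_iInter_of_finite fun i => isOpen_lt continuous_const ?_
  exact (continuous_simplexDet.comp (continuous_const.update i continuous_id)).mul continuous_const

theorem isClosed_wideSimplex {d : ℕ} (u : Fin (d + 1) → EuclideanSpace ℝ (Fin d)) :
    IsClosed (wideSimplex u) := by
  have : wideSimplex u = ⋂ i, {x | |simplexDet (Function.update u i x)| ≤ |simplexDet u|} := by
    ext x; simp [wideSimplex]
  rw [this]
  refine isClosed_iInter fun i => isClosed_le ?_ continuous_const
  exact (continuous_simplexDet.comp (continuous_const.update i continuous_id)).abs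

theorem openSimplex_subset_convexHull {d : ℕ} (u : Fin (d + 1) → EuclideanSpace ℝ (Fin d)) :
    openSimplex u ⊆ convexHull ℝ (Set.range u) := by
  intro x hx
  have hu : simplexDet u ≠ 0 := fun h => by simpa [h] using hx 0
  have hc := Matrix.mulVec_cramer (homMatrix u).transpose (homCoord x)
  rw [Matrix.det_transpose] at hc
  set b : Fin (d + 1) → ℝ := fun i => simplexDet (Function.update u i x) / simplexDet u with hb
  have hcr : ∀ i, Matrix.cramer (homMatrix u).transpose (homCoord x) i = b i * simplexDet u := by
    intro i
    rw [Matrix.cramer_transpose_apply, ← homMatrix_update, hb]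
    simp only
    rw [div_mul_cancel₀ _ hu, simplexDet]
  have hrow : ∀ j, ∑ i, b i * homMatrix u i j = homCoord x j := by
    intro j
    have h := congrFun hc j
    simp only [Matrix.mulVec, dotProduct, Matrix.transpose_apply, Pi.smul_apply, smul_eq_mul,
      hcr] at h
    refine mul_left_cancel₀ hu (Eq.trans ?_ h)
    rw [Finset.mul_sum]
    exact Finset.sum_congr rfl fun i _ => by ring
  have hpos : ∀ i, 0 ≤ b i := by
    intro i
    rw [hb]
    simp only
    rw [← mul_div_mul_right _ _ hu]
    exact div_nonneg (hx i).le (mul_self_nonneg _)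
  have hsum : ∑ i, b i = 1 := by simpa [homMatrix, homCoord] using hrow 0
  have hx' : x = ∑ i, b i • u i := by
    ext j
    simpa [homMatrix, homCoord] using (hrow j.succ).symm
  rw [hx']
  exact (convex_convexHull ℝ _).sum_mem (fun i _ => hpos i) hsum
    fun i _ => subset_convexHull ℝ _ ⟨i, rfl⟩

theorem openSimplex_subset_interior {d : ℕ} (u : Fin (d + 1) → EuclideanSpace ℝ (Fin d)) :
    openSimplex u ⊆ interior (convexHull ℝ (Set.range u)) :=
  interior_maximal (openSimplex_subset_convexHull u) (isOpen_openSimplex u)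

theorem le_volume_openSimplex_range {d : ℕ} (u : Fin (d + 1) → EuclideanSpace ℝ (Fin d))
    (hu : simplexDet u ≠ 0) :
    ENNReal.ofReal (|simplexDet u| / d.factorial) ≤ volume (openSimplex u) := by
  rw [← lintegral_indicator_one (isOpen_openSimplex u).measurableSet,
    lintegral_comp_simplex u hu (measurable_one.indicator (isOpen_openSimplex u).measurableSet),
    div_eq_mul_one_div, ENNReal.ofReal_mul (abs_nonneg _)]
  gcongr
  rw [← one_pow d]
  refine (le_volume_openSimplex d one_pos).trans ?_
  rw [← lintegral_indicator_one (measurableSet_openSimplex d 1)]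
  refine lintegral_mono fun y => ?_
  by_cases h : y ∈ {y : Fin d → ℝ | (∀ i, 0 < y i) ∧ ∑ i, y i < 1}
  swap
  · rw [Set.indicator_of_notMem h]
    exact zero_le
  have : u 0 + ∑ i, y i • (u i.succ - u 0) ∈ openSimplex u := by
    intro i
    rw [simplexDet_update_affine, mul_assoc]
    refine mul_pos ?_ (mul_self_pos.2 hu)
    exact Fin.cases (sub_pos.2 h.2) h.1 i
  rw [Set.indicator_of_mem h, Set.indicator_of_mem this]
  rfl

theorem volume_wideSimplex_le {d : ℕ} (u : Fin (d + 1) → EuclideanSpace ℝ (Fin d))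
    (hu : simplexDet u ≠ 0) :
    volume (wideSimplex u) ≤ ENNReal.ofReal (2 ^ d * |simplexDet u|) := by
  have hm := (isClosed_wideSimplex u).measurableSet
  rw [← lintegral_indicator_one hm, lintegral_comp_simplex u hu (measurable_one.indicator hm),
    mul_comm ((2 : ℝ) ^ d), ENNReal.ofReal_mul (abs_nonneg _)]
  gcongr
  calc _ ≤ ∫⁻ y : Fin d → ℝ,
        (Set.Icc (fun _ => -1) (fun _ => 1)).indicator (1 : (Fin d → ℝ) → ENNReal) y := by
        refine lintegral_mono fun y => ?_
        by_cases h : u 0 + ∑ i, y i • (u i.succ - u 0) ∈ wideSimplex u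
        swap
        · simp only [Set.indicator_of_notMem h]
          exact zero_le
        have hy : y ∈ Set.Icc (fun _ : Fin d => (-1 : ℝ)) (fun _ => 1) := by
          have : ∀ i, |y i| ≤ 1 := by
            intro i
            have := h i.succ
            rw [simplexDet_update_affine, abs_mul, Fin.cons_succ] at this
            exact le_of_mul_le_mul_right (by simpa using this) (abs_pos.2 hu)
          exact ⟨fun i => (abs_le.1 (this i)).1, fun i => (abs_le.1 (this i)).2⟩
        rw [Set.indicator_of_mem hy, Set.indicator_of_mem h]
        rfl
    _ = ENNReal.ofReal (2 ^ d) := by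
        rw [lintegral_indicator_one measurableSet_Icc, Real.volume_Icc_pi]
        norm_num

theorem lintegral_comp_mul_left (h : ℝ → ENNReal) (hh : Measurable h) {a : ℝ} (ha : a ≠ 0) :
    ENNReal.ofReal |a| * ∫⁻ t, h (a * t) = ∫⁻ t, h t := by
  conv_rhs => rw [← Real.smul_map_volume_mul_left ha]
  rw [lintegral_smul_measure, lintegral_map hh (by fun_prop), smul_eq_mul]

theorem lintegral_comp_abs_le (h : ℝ → ENNReal) (hh : Measurable h) (h0 : h 0 = 0) :
    ∫⁻ t, h |t| ≤ 2 * ∫⁻ t in Set.Ioi 0, h t := by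
  have hm : Measurable ((Set.Ioi (0 : ℝ)).indicator h) := hh.indicator measurableSet_Ioi
  calc ∫⁻ t, h |t|
      ≤ ∫⁻ t, ((Set.Ioi (0 : ℝ)).indicator h t + (Set.Ioi (0 : ℝ)).indicator h (-t)) := by
        refine lintegral_mono fun t => ?_
        rcases lt_trichotomy t 0 with ht | rfl | ht
        · rw [Set.indicator_of_mem (show -t ∈ Set.Ioi (0 : ℝ) by simpa using ht), abs_of_neg ht]
          exact le_add_self
        · simp [h0]
        · rw [Set.indicator_of_mem (show t ∈ Set.Ioi (0 : ℝ) from ht), abs_of_pos ht]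
          exact le_self_add
    _ = _ := by
        rw [lintegral_add_left hm, lintegral_neg_eq_self, two_mul,
          lintegral_indicator measurableSet_Ioi]

theorem facetDet_cons_zero {d : ℕ} (x : EuclideanSpace ℝ (Fin d))
    (q : Fin d → EuclideanSpace ℝ (Fin d)) :
    facetDet (Fin.cons x q) 0 =
      (Matrix.of (Fin.cons (homDir d) fun i => homCoord (q i) :
        Fin (d + 1) → Fin (d + 1) → ℝ)).det := by
  rw [facetDet]
  congr 1
  ext i j
  refine Fin.cases ?_ (fun i => ?_) i <;> simp [homMatrix]

theorem homCoord_add_smul {d : ℕ} (q : Fin (d + 1) → EuclideanSpace ℝ (Fin (d + 1)))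
    (t : ℝ) (b : Fin d → ℝ) :
    homCoord (q 0 + ∑ i, (Fin.cons t b : Fin (d + 1) → ℝ) i •
      (Fin.cons (WithLp.toLp 2 1) fun j => q j.succ - q 0 :
        Fin (d + 1) → EuclideanSpace ℝ (Fin (d + 1))) i) =
      ∑ k, (Fin.cons t (Fin.cons (1 - ∑ j, b j) b) : Fin (d + 2) → ℝ) k •
        (Fin.cons (homDir (d + 1)) fun i => homCoord (q i) : Fin (d + 2) → Fin (d + 2) → ℝ) k := by
  ext j
  simp only [Fin.sum_univ_succ, Fin.cons_zero, Fin.cons_succ]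
  refine Fin.cases ?_ (fun j => ?_) j
  · simp [homCoord, homDir]
  · simp [homCoord, homDir, mul_sub, Finset.sum_sub_distrib, sub_mul, Finset.sum_mul]
    ring

theorem abs_det_cons_sub {d : ℕ} (q : Fin (d + 1) → EuclideanSpace ℝ (Fin (d + 1))) :
    |(Matrix.of fun i j => (Fin.cons (WithLp.toLp 2 1) fun j => q j.succ - q 0 :
        Fin (d + 1) → EuclideanSpace ℝ (Fin (d + 1))) i j).det| =
      |(Matrix.of (Fin.cons (homDir (d + 1)) fun i => homCoord (q i) :
        Fin (d + 2) → Fin (d + 2) → ℝ)).det| := by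
  set N := Matrix.of (Fin.cons (homDir (d + 1)) fun i => homCoord (q i) :
        Fin (d + 2) → Fin (d + 2) → ℝ) with hN
  have h1 : |(N.submatrix (Equiv.swap 0 1) id).det| = |N.det| := by
    rw [Matrix.det_permute, abs_mul, Equiv.Perm.sign_swap (by simp)]
    simp
  rw [← h1, det_eq_det_sub_mul (N.submatrix (Equiv.swap 0 1) id)]
  · congr 2
    ext i j
    refine Fin.cases ?_ (fun i => ?_) i
    · simp [hN, homDir, homCoord]
    · rw [Matrix.of_apply, Matrix.of_apply, Matrix.submatrix_apply, Matrix.submatrix_apply,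
        Matrix.submatrix_apply, Equiv.swap_apply_left,
        Equiv.swap_apply_of_ne_of_ne (by simp) (by simp [Fin.ext_iff])]
      have : (1 : Fin (d + 2)) = Fin.succ 0 := rfl
      simp only [hN, Matrix.of_apply, this, Fin.cons_succ, homCoord, id, Fin.cons_zero]
      simp
  · have : (1 : Fin (d + 2)) = Fin.succ 0 := rfl
    rw [Matrix.submatrix_apply, Equiv.swap_apply_left, hN, Matrix.of_apply, this, Fin.cons_succ]
    simp [homCoord]

theorem simplexDet_cons_affine {d : ℕ} (q : Fin (d + 1) → EuclideanSpace ℝ (Fin (d + 1)))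
    (t : ℝ) (b : Fin d → ℝ) :
    simplexDet (Fin.cons (q 0 + ∑ i, (Fin.cons t b : Fin (d + 1) → ℝ) i •
      (Fin.cons (WithLp.toLp 2 1) fun j => q j.succ - q 0 :
        Fin (d + 1) → EuclideanSpace ℝ (Fin (d + 1))) i) q) =
      t * (Matrix.of (Fin.cons (homDir (d + 1)) fun i => homCoord (q i) :
        Fin (d + 2) → Fin (d + 2) → ℝ)).det := by
  set N := Matrix.of (Fin.cons (homDir (d + 1)) fun i => homCoord (q i) :
        Fin (d + 2) → Fin (d + 2) → ℝ) with hN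
  have := Matrix.det_updateRow_sum N 0 (Fin.cons t (Fin.cons (1 - ∑ j, b j) b))
  rw [Fin.cons_zero, smul_eq_mul] at this
  rw [← this, simplexDet]
  congr 1
  ext i j
  refine Fin.cases ?_ (fun i => ?_) i
  · rw [Matrix.updateRow_self, homMatrix, Matrix.of_apply, Fin.cons_zero, homCoord_add_smul]
    rfl
  · rw [Matrix.updateRow_ne (by simp)]
    simp [homMatrix, hN]

theorem abs_facetDet_cons_affine {d : ℕ} (q : Fin (d + 1) → EuclideanSpace ℝ (Fin (d + 1)))
    (t : ℝ) (b : Fin d → ℝ) (j : Fin (d + 1)) :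
    |facetDet (Fin.cons (q 0 + ∑ i, (Fin.cons t b : Fin (d + 1) → ℝ) i •
      (Fin.cons (WithLp.toLp 2 1) fun j => q j.succ - q 0 :
        Fin (d + 1) → EuclideanSpace ℝ (Fin (d + 1))) i) q) j.succ| =
      |(Fin.cons (1 - ∑ j, b j) b : Fin (d + 1) → ℝ) j| *
      |(Matrix.of (Fin.cons (homDir (d + 1)) fun i => homCoord (q i) :
        Fin (d + 2) → Fin (d + 2) → ℝ)).det| := by
  set N := Matrix.of (Fin.cons (homDir (d + 1)) fun i => homCoord (q i) :
        Fin (d + 2) → Fin (d + 2) → ℝ) with hN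
  have := Matrix.det_updateRow_sum N j.succ (Fin.cons t (Fin.cons (1 - ∑ j, b j) b))
  rw [Fin.cons_succ, smul_eq_mul] at this
  rw [← abs_mul, ← this]
  set A := N.updateRow j.succ
    (∑ k, (Fin.cons t (Fin.cons (1 - ∑ j, b j) b) : Fin (d + 2) → ℝ) k • N k) with hA
  have h1 : |(A.submatrix (Equiv.swap 0 j.succ) id).det| = |A.det| := by
    rw [Matrix.det_permute, abs_mul, Equiv.Perm.sign_swap (Fin.succ_ne_zero j).symm]
    simp
  rw [← h1, facetDet]
  congr 2
  ext i l
  rw [Matrix.submatrix_apply]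
  refine Fin.cases ?_ (fun i => ?_) i
  · rw [Equiv.swap_apply_left, hA, Matrix.updateRow_self,
      Matrix.updateRow_ne (Fin.succ_ne_zero j).symm,
      homMatrix, Matrix.of_apply, Fin.cons_zero, homCoord_add_smul]
    rfl
  · rcases eq_or_ne i j with rfl | h
    · rw [Equiv.swap_apply_right, hA, Matrix.updateRow_self,
        Matrix.updateRow_ne (Fin.succ_ne_zero i).symm]
      simp [hN]
    · have h' : i.succ ≠ j.succ := by simpa using h
      rw [Equiv.swap_apply_of_ne_of_ne (by simp) h', hA, Matrix.updateRow_ne h',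
        Matrix.updateRow_ne h']
      simp [hN, homMatrix]

theorem lintegral_maximal_facet_le {d : ℕ} [NeZero d]
    (q : Fin (d + 1) → EuclideanSpace ℝ (Fin (d + 1)))
    (g : ℝ → ENNReal) (hg : Measurable g) (hg0 : g 0 = 0) :
    ∫⁻ x, {x | ∀ j, |facetDet (Fin.cons x q) j| ≤ |facetDet (Fin.cons x q) 0|}.indicator
      (fun x => g |simplexDet (Fin.cons x q)|) x ≤
      ENNReal.ofReal (2 ^ d) * ∫⁻ t in Set.Ioi 0, g t := by
  set D := (Matrix.of (Fin.cons (homDir (d + 1)) fun i => homCoord (q i) :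
        Fin (d + 2) → Fin (d + 2) → ℝ)).det with hD
  have hcons : Continuous fun x : EuclideanSpace ℝ (Fin (d + 1)) =>
      (Fin.cons x q : Fin (d + 2) → EuclideanSpace ℝ (Fin (d + 1))) :=
    continuous_pi (Fin.cases (by simpa using continuous_id') fun i =>
      by simpa using continuous_const)
  have hmS : MeasurableSet
      {x | ∀ j, |facetDet (Fin.cons x q) j| ≤ |facetDet (Fin.cons x q) 0|} := by
    have : {x | ∀ j, |facetDet (Fin.cons x q) j| ≤ |facetDet (Fin.cons x q) 0|} =
        ⋂ j, {x | |facetDet (Fin.cons x q) j| ≤ |facetDet (Fin.cons x q) 0|} := by ext; simp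
    rw [this]
    exact MeasurableSet.iInter fun j => (isClosed_le ((continuous_facetDet j).comp hcons).abs
      ((continuous_facetDet 0).comp hcons).abs).measurableSet
  have hmf : Measurable ({x | ∀ j, |facetDet (Fin.cons x q) j| ≤
      |facetDet (Fin.cons x q) 0|}.indicator (fun x => g |simplexDet (Fin.cons x q)|)) :=
    (hg.comp (continuous_simplexDet.comp hcons).abs.measurable).indicator hmS
  by_cases h0 : D = 0
  · refine le_of_eq_of_le ?_ zero_le
    refine lintegral_eq_zero_of_ae_eq_zero (ae_of_all _ fun x => ?_)
    by_cases hx : x ∈ {x | ∀ j, |facetDet (Fin.cons x q) j| ≤ |facetDet (Fin.cons x q) 0|}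
    · have : simplexDet (Fin.cons x q) = 0 := by
        by_contra h
        exact facetDet_ne_zero _ h hx (by rw [facetDet_cons_zero, ← hD, h0])
      simp [Set.indicator_of_mem hx, this, hg0]
    · simp [Set.indicator_of_notMem hx]
  have habs := abs_det_cons_sub q
  rw [← hD] at habs
  rw [lintegral_comp_affine (q 0) _ (abs_ne_zero.1 (habs ▸ abs_ne_zero.2 h0)) hmf, habs]
  set P := {y : Fin d → ℝ | (∀ i, |y i| ≤ 1) ∧ 0 ≤ ∑ i, y i} with hP
  have hPm : MeasurableSet P := measurableSet_cube_half d
  have hgm : Measurable fun t => g |t * D| := by fun_prop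
  calc _ ≤ ENNReal.ofReal |D| * ∫⁻ y : Fin (d + 1) → ℝ,
          g |y 0 * D| * P.indicator 1 (Fin.tail y) := by
        gcongr with y
        obtain ⟨t, b, rfl⟩ : ∃ t b, y = Fin.cons t b :=
          ⟨y 0, Fin.tail y, (Fin.cons_self_tail y).symm⟩
        refine Set.indicator_apply_le' (fun hx => ?_) (fun _ => zero_le)
        rw [simplexDet_cons_affine, ← hD, Fin.cons_zero, Fin.tail_cons]
        have hb : ∀ j, |(Fin.cons (1 - ∑ j, b j) b : Fin (d + 1) → ℝ) j| ≤ 1 := by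
          intro j
          have := hx j.succ
          rw [abs_facetDet_cons_affine, facetDet_cons_zero, ← hD] at this
          exact le_of_mul_le_mul_right (by simpa using this) (abs_pos.2 h0)
        have hbP : b ∈ P := by
          refine ⟨fun i => hb i.succ, ?_⟩
          have := (abs_le.1 (hb 0)).2
          rw [Fin.cons_zero] at this
          linarith
        rw [Set.indicator_of_mem hbP]
        simp
    _ = ENNReal.ofReal |D| * ((∫⁻ t, g |t * D|) * volume P) := by
        rw [volume_pi, lintegral_pi_fin_succ]
        · simp only [Fin.cons_zero, Fin.tail_cons]
          congr 1
          rw [← lintegral_mul_const _ hgm]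
          refine lintegral_congr fun t => ?_
          rw [lintegral_const_mul _ (measurable_one.indicator hPm), lintegral_indicator_one hPm]
          rfl
        · refine Measurable.mul (by fun_prop) ((measurable_one.indicator hPm).comp ?_)
          exact measurable_pi_lambda _ fun i => measurable_pi_apply _
    _ ≤ _ := by
        rw [← mul_assoc]
        simp_rw [mul_comm _ D]
        rw [lintegral_comp_mul_left (fun t => g |t|) (by fun_prop) h0]
        refine (mul_le_mul' (lintegral_comp_abs_le g hg hg0) (volume_cube_half d)).trans
          (le_of_eq ?_)
        obtain ⟨e, rfl⟩ : ∃ e, d = e + 1 := Nat.exists_eq_succ_of_ne_zero (NeZero.ne d)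
        rw [pow_succ' (2 : ℝ) e, ENNReal.ofReal_mul (by norm_num), ENNReal.ofReal_ofNat]
        simp only [Nat.add_sub_cancel]
        ring

theorem pi_sum_setOf_forall_mem {α ι₁ ι₂ : Type*} [MeasurableSpace α] [Fintype ι₁] [Fintype ι₂]
    (μ : Measure α) [SigmaFinite μ] {G : Set (ι₁ → α)} (hG : MeasurableSet G)
    {A : ι₂ → (ι₁ → α) → Set α} (hA : ∀ j, MeasurableSet {p : (ι₁ → α) × α | p.2 ∈ A j p.1}) :
    Measure.pi (fun _ : ι₁ ⊕ ι₂ => μ)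
      {S | S ∘ Sum.inl ∈ G ∧ ∀ j, S (Sum.inr j) ∈ A j (S ∘ Sum.inl)} =
      ∫⁻ u in G, ∏ j, μ (A j u) ∂(Measure.pi fun _ => μ) := by
  have h := measurePreserving_sumPiEquivProdPi (fun _ : ι₁ ⊕ ι₂ => μ)
  set Q : Set ((ι₁ → α) × (ι₂ → α)) := {p | p.1 ∈ G ∧ ∀ j, p.2 j ∈ A j p.1} with hQ
  have hQm : MeasurableSet Q := by
    have : Q = (Prod.fst ⁻¹' G) ∩ ⋂ j, (fun p : (ι₁ → α) × (ι₂ → α) => (p.1, p.2 j)) ⁻¹'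
        {p : (ι₁ → α) × α | p.2 ∈ A j p.1} := by
      ext p; simp [hQ]
    rw [this]
    exact (measurable_fst hG).inter (MeasurableSet.iInter fun j =>
      (measurable_fst.prodMk ((measurable_pi_apply j).comp measurable_snd)) (hA j))
  have hpre : {S : ι₁ ⊕ ι₂ → α | S ∘ Sum.inl ∈ G ∧ ∀ j, S (Sum.inr j) ∈ A j (S ∘ Sum.inl)} =
      (MeasurableEquiv.sumPiEquivProdPi fun _ : ι₁ ⊕ ι₂ => α) ⁻¹' Q := rfl
  rw [hpre, h.measure_preimage hQm.nullMeasurableSet, Measure.prod_apply hQm,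
    ← lintegral_indicator hG]
  refine lintegral_congr fun u => ?_
  by_cases hu : u ∈ G
  · rw [Set.indicator_of_mem hu, ← Measure.pi_pi]
    congr 1
    ext v
    simp [hQ, hu]
  · rw [Set.indicator_of_notMem hu]
    have : Prod.mk u ⁻¹' Q = ∅ := by ext v; simp [hQ, hu]
    rw [this, measure_empty]

theorem pi_setOf_comp_equiv {α ι ι' : Type*} [MeasurableSpace α] [Fintype ι] [Fintype ι']
    (μ : Measure α) [SigmaFinite μ] (e : ι ≃ ι') (X : Set (ι → α)) :
    Measure.pi (fun _ : ι' => μ) {S | S ∘ e ∈ X} = Measure.pi (fun _ : ι => μ) X := by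
  rw [← (measurePreserving_piCongrLeft (fun _ : ι' => μ) e).measure_preimage_equiv]
  congr 1
  ext S
  have : (MeasurableEquiv.piCongrLeft (fun _ => α) e S) ∘ e = S := by
    funext i
    exact Equiv.piCongrLeft_apply_apply (fun _ => α) e S i
  simp [this]

/-- An upper bound for the probability that `m` points lie in `wideSimplex u` and `r` points avoid
`openSimplex u`, as a function of `|simplexDet u|`. -/
noncomputable def simplexWeight (d m r : ℕ) : ℝ → ENNReal :=
  (Set.Ioc (0 : ℝ) d.factorial).indicator fun s =>
    ENNReal.ofReal (2 ^ d * s) ^ m * ENNReal.ofReal (1 - s / d.factorial) ^ r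

theorem measurable_simplexWeight (d m r : ℕ) : Measurable (simplexWeight d m r) :=
  Measurable.indicator (by fun_prop) measurableSet_Ioc

theorem lintegral_simplexWeight (d m r : ℕ) :
    ∫⁻ t in Set.Ioi 0, simplexWeight d m r t =
      ENNReal.ofReal (d.factorial * (2 ^ d * d.factorial) ^ m *
        (m.factorial * r.factorial / (m + r + 1).factorial)) := by
  have hd : (0 : ℝ) < d.factorial := by positivity
  have hsupp : (Set.Ioi 0).indicator (simplexWeight d m r) = simplexWeight d m r :=
    Set.indicator_eq_self.2 (Set.support_indicator_subset.trans Set.Ioc_subset_Ioi_self)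
  rw [← lintegral_indicator measurableSet_Ioi, hsupp,
    ← lintegral_comp_mul_left _ (measurable_simplexWeight d m r) hd.ne', abs_of_pos hd, mul_assoc,
    ENNReal.ofReal_mul hd.le, ENNReal.ofReal_mul (by positivity), ← lintegral_pow_mul_one_sub_pow,
    setLIntegral_congr Ioo_ae_eq_Ioc,
    ← lintegral_const_mul (ENNReal.ofReal ((2 ^ d * d.factorial) ^ m)) (by fun_prop),
    ← lintegral_indicator measurableSet_Ioc]
  congr 1
  refine lintegral_congr fun t => ?_
  have hiff : (d.factorial : ℝ) * t ∈ Set.Ioc (0 : ℝ) d.factorial ↔ t ∈ Set.Ioc (0 : ℝ) 1 := by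
    simp only [Set.mem_Ioc, mul_pos_iff_of_pos_left hd]
    rw [mul_le_iff_le_one_right hd]
  by_cases ht : t ∈ Set.Ioc (0 : ℝ) 1
  · have h0 := ht.1.le
    have h1 := sub_nonneg.2 ht.2
    rw [simplexWeight, Set.indicator_of_mem (hiff.2 ht), Set.indicator_of_mem ht,
      ← ENNReal.ofReal_pow (by positivity), mul_div_cancel_left₀ _ hd.ne',
      ← ENNReal.ofReal_pow h1, ← ENNReal.ofReal_mul (by positivity),
      ← ENNReal.ofReal_mul (by positivity)]
    congr 1
    ring
  · rw [simplexWeight, Set.indicator_of_notMem (mt hiff.1 ht), Set.indicator_of_notMem ht]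

theorem prod_measure_le_simplexWeight {d : ℕ} (m r : ℕ) {K : Set (EuclideanSpace ℝ (Fin d))}
    (hKconv : Convex ℝ K) (hKvol : volume K = 1)
    (u : Fin (d + 1) → EuclideanSpace ℝ (Fin d)) (hu : simplexDet u ≠ 0) (huK : ∀ i, u i ∈ K) :
    volume.restrict K (wideSimplex u) ^ m * volume.restrict K (openSimplex u)ᶜ ^ r ≤
      simplexWeight d m r |simplexDet u| := by
  have hd : (0 : ℝ) < d.factorial := by positivity
  have hsub : openSimplex u ⊆ K := (openSimplex_subset_convexHull u).trans
    (convexHull_min (Set.range_subset_iff.2 huK) hKconv)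
  have hvol := le_volume_openSimplex_range u hu
  have h1 : |simplexDet u| / d.factorial ≤ 1 := by
    have := hvol.trans (measure_mono hsub)
    rwa [hKvol, ENNReal.ofReal_le_one] at this
  have hmem : |simplexDet u| ∈ Set.Ioc (0 : ℝ) d.factorial :=
    ⟨abs_pos.2 hu, by rwa [div_le_one hd] at h1⟩
  have : IsProbabilityMeasure (volume.restrict K) := ⟨by simpa using hKvol⟩
  rw [simplexWeight, Set.indicator_of_mem hmem]
  gcongr
  · exact (Measure.restrict_apply_le _ _).trans (volume_wideSimplex_le u hu)
  · rw [prob_compl_eq_one_sub (isOpen_openSimplex u).measurableSet,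
      Measure.restrict_eq_self _ hsub, ENNReal.ofReal_sub _ (by positivity), ENNReal.ofReal_one]
    gcongr

theorem measurableSet_maximal_facet (d : ℕ) : MeasurableSet
    {u : Fin (d + 1) → EuclideanSpace ℝ (Fin d) | ∀ j, |facetDet u j| ≤ |facetDet u 0|} := by
  rw [Set.ofPred_forall]
  exact MeasurableSet.iInter fun j =>
    (isClosed_le (continuous_facetDet j).abs (continuous_facetDet 0).abs).measurableSet

theorem lintegral_simplexWeight_pi_le {d : ℕ} [NeZero d] (m r : ℕ)
    {K : Set (EuclideanSpace ℝ (Fin (d + 1)))} (hKvol : volume K = 1) :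
    ∫⁻ u, {u : Fin (d + 2) → EuclideanSpace ℝ (Fin (d + 1)) |
        ∀ j, |facetDet u j| ≤ |facetDet u 0|}.indicator
        (fun u => simplexWeight (d + 1) m r |simplexDet u|) u
        ∂(Measure.pi fun _ => volume.restrict K) ≤
      ENNReal.ofReal (2 ^ d * ((d + 1).factorial * (2 ^ (d + 1) * (d + 1).factorial) ^ m *
        (m.factorial * r.factorial / (m + r + 1).factorial))) := by
  have : IsProbabilityMeasure (volume.restrict K) := ⟨by simpa using hKvol⟩
  have hw := measurable_simplexWeight (d + 1) m r
  have hf : Measurable ({u : Fin (d + 2) → EuclideanSpace ℝ (Fin (d + 1)) |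
        ∀ j, |facetDet u j| ≤ |facetDet u 0|}.indicator
        (fun u => simplexWeight (d + 1) m r |simplexDet u|)) :=
    (hw.comp continuous_simplexDet.abs.measurable).indicator (measurableSet_maximal_facet _)
  rw [lintegral_pi_fin_succ_symm _ _ hf, ENNReal.ofReal_mul (by positivity),
    ← lintegral_simplexWeight]
  calc _ ≤ ∫⁻ _ : Fin (d + 1) → EuclideanSpace ℝ (Fin (d + 1)),
          (ENNReal.ofReal (2 ^ d) * ∫⁻ t in Set.Ioi 0, simplexWeight (d + 1) m r t)
          ∂(Measure.pi fun _ => volume.restrict K) := by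
        refine lintegral_mono fun q => ?_
        exact (lintegral_mono' Measure.restrict_le_self le_rfl).trans
          (lintegral_maximal_facet_le q _ hw (by simp [simplexWeight]))
    _ = _ := by simp

theorem measurableSet_mem_wideSimplex (d : ℕ) : MeasurableSet
    {p : (Fin (d + 1) → EuclideanSpace ℝ (Fin d)) × EuclideanSpace ℝ (Fin d) |
      p.2 ∈ wideSimplex p.1} := by
  have : {p : (Fin (d + 1) → EuclideanSpace ℝ (Fin d)) × EuclideanSpace ℝ (Fin d) |
      p.2 ∈ wideSimplex p.1} =
      ⋂ i, {p | |simplexDet (Function.update p.1 i p.2)| ≤ |simplexDet p.1|} := by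
    ext; simp [wideSimplex]
  rw [this]
  exact MeasurableSet.iInter fun i => (isClosed_le
    (continuous_simplexDet.comp (continuous_fst.update i continuous_snd)).abs
    (continuous_simplexDet.comp continuous_fst).abs).measurableSet

theorem measurableSet_mem_openSimplex (d : ℕ) : MeasurableSet
    {p : (Fin (d + 1) → EuclideanSpace ℝ (Fin d)) × EuclideanSpace ℝ (Fin d) |
      p.2 ∈ openSimplex p.1} := by
  have : {p : (Fin (d + 1) → EuclideanSpace ℝ (Fin d)) × EuclideanSpace ℝ (Fin d) |
      p.2 ∈ openSimplex p.1} =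
      ⋂ i, {p | 0 < simplexDet (Function.update p.1 i p.2) * simplexDet p.1} := by
    ext; simp [openSimplex]
  rw [this]
  exact MeasurableSet.iInter fun i => (isOpen_lt continuous_const
    ((continuous_simplexDet.comp (continuous_fst.update i continuous_snd)).mul
    (continuous_simplexDet.comp continuous_fst))).measurableSet

theorem pi_hole_event_le {d : ℕ} [NeZero d] {m r n : ℕ}
    {K : Set (EuclideanSpace ℝ (Fin (d + 1)))}
    (hKm : MeasurableSet K) (hKconv : Convex ℝ K) (hKvol : volume K = 1)
    (e : Fin (d + 2) ⊕ (Fin m ⊕ Fin r) ≃ Fin n) :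
    Measure.pi (fun _ : Fin n => volume.restrict K)
      {S | (simplexDet (S ∘ e ∘ Sum.inl) ≠ 0 ∧
          ∀ j, |facetDet (S ∘ e ∘ Sum.inl) j| ≤ |facetDet (S ∘ e ∘ Sum.inl) 0|) ∧
        (∀ j, S (e (Sum.inr (Sum.inl j))) ∈ wideSimplex (S ∘ e ∘ Sum.inl)) ∧
        ∀ j, S (e (Sum.inr (Sum.inr j))) ∉ openSimplex (S ∘ e ∘ Sum.inl)} ≤
      ENNReal.ofReal (2 ^ d * ((d + 1).factorial * (2 ^ (d + 1) * (d + 1).factorial) ^ m *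
        (m.factorial * r.factorial / (m + r + 1).factorial))) := by
  have : IsProbabilityMeasure (volume.restrict K) := ⟨by simpa using hKvol⟩
  set G : Set (Fin (d + 2) → EuclideanSpace ℝ (Fin (d + 1))) :=
    {u | simplexDet u ≠ 0 ∧ ∀ j, |facetDet u j| ≤ |facetDet u 0|} with hG
  have hGm : MeasurableSet G :=
    (isClosed_singleton.preimage continuous_simplexDet).isOpen_compl.measurableSet.inter
      (measurableSet_maximal_facet _)
  set A : Fin m ⊕ Fin r → (Fin (d + 2) → EuclideanSpace ℝ (Fin (d + 1))) →
      Set (EuclideanSpace ℝ (Fin (d + 1))) :=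
    fun j u => Sum.elim (fun _ => wideSimplex u) (fun _ => (openSimplex u)ᶜ) j with hA
  have hAm : ∀ j, MeasurableSet {p : (Fin (d + 2) → EuclideanSpace ℝ (Fin (d + 1))) ×
      EuclideanSpace ℝ (Fin (d + 1)) | p.2 ∈ A j p.1} := by
    rintro (j | j)
    · exact measurableSet_mem_wideSimplex (d + 1)
    · exact (measurableSet_mem_openSimplex (d + 1)).compl
  have hK : ∀ᵐ u ∂(Measure.pi fun _ : Fin (d + 2) => volume.restrict K), ∀ i, u i ∈ K :=
    ae_all_iff.2 fun i => Measure.tendsto_eval_ae_ae (ae_restrict_mem hKm)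
  calc _ = ∫⁻ u in G, ∏ j, volume.restrict K (A j u)
          ∂(Measure.pi fun _ => volume.restrict K) := by
        rw [← pi_sum_setOf_forall_mem _ hGm hAm, ← pi_setOf_comp_equiv (volume.restrict K) e]
        congr 1
        ext S
        simp only [Sum.forall]
        rfl
    _ ≤ _ := by
        refine le_trans ?_ (lintegral_simplexWeight_pi_le m r hKvol)
        rw [← lintegral_indicator hGm]
        refine lintegral_mono_ae ?_
        filter_upwards [hK] with u huK
        refine Set.indicator_apply_le' (fun hu => ?_) (fun _ => zero_le)
        have hmem : u ∈ {u : Fin (d + 2) → EuclideanSpace ℝ (Fin (d + 1)) |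
          ∀ j, |facetDet u j| ≤ |facetDet u 0|} := hu.2
        rw [Set.indicator_of_mem hmem, Fintype.prod_sum_type]
        simpa [hA] using prod_measure_le_simplexWeight m r hKconv hKvol u hu.1 huK

theorem exists_simplexDet_ne_zero (d : ℕ) :
    ∃ a : Fin (d + 1) → EuclideanSpace ℝ (Fin d), simplexDet a ≠ 0 := by
  refine ⟨Fin.cons 0 fun i => EuclideanSpace.single i 1, ?_⟩
  have h : (Matrix.of fun i j : Fin d =>
      (Fin.cons 0 (fun i => EuclideanSpace.single i 1) :
        Fin (d + 1) → EuclideanSpace ℝ (Fin d)) i.succ j -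
      (Fin.cons 0 (fun i => EuclideanSpace.single i 1) :
        Fin (d + 1) → EuclideanSpace ℝ (Fin d)) 0 j) = (1 : Matrix (Fin d) (Fin d) ℝ) := by
    ext i j
    simp [Matrix.one_apply, eq_comm]
  rw [simplexDet_eq, h, Matrix.det_one]
  exact one_ne_zero

theorem ae_simplexDet_add_smul_ne_zero {d : ℕ} (b a : Fin (d + 1) → EuclideanSpace ℝ (Fin d))
    (ha : simplexDet a ≠ 0) : ∀ᵐ t : ℝ, simplexDet (b + t • a) ≠ 0 := by
  let A : Matrix (Fin d) (Fin d) ℝ := Matrix.of fun i j => a i.succ j - a 0 j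
  let B : Matrix (Fin d) (Fin d) ℝ := Matrix.of fun i j => b i.succ j - b 0 j
  let P : Polynomial ℝ :=
    ((Polynomial.X : Polynomial ℝ) • A.map Polynomial.C + B.map Polynomial.C).det
  have hP : P ≠ 0 := fun h => by
    have := Polynomial.coeff_det_X_add_C_card A B
    rw [← simplexDet_eq, show Matrix.det _ = P from rfl, h, Polynomial.coeff_zero] at this
    exact ha this.symm
  have heval : ∀ t, simplexDet (b + t • a) = P.eval t := fun t => by
    rw [simplexDet_eq, ← Polynomial.coe_evalRingHom, RingHom.map_det]
    congr 1
    ext i j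
    simp [A, B]
    ring
  have : {t | P.IsRoot t}.Finite := Polynomial.finite_setOfPred_isRoot hP
  filter_upwards [this.countable.ae_notMem volume] with t ht
  rw [heval]
  exact ht

theorem ae_simplexDet_comp_ne_zero {d n : ℕ} (K : Set (EuclideanSpace ℝ (Fin d)))
    (p : Fin (d + 1) ↪ Fin n) :
    ∀ᵐ S ∂(Measure.pi fun _ : Fin n => volume.restrict K), simplexDet (S ∘ p) ≠ 0 := by
  rw [← Measure.restrict_pi_pi]
  refine ae_restrict_of_ae ?_
  obtain ⟨a, ha⟩ := exists_simplexDet_ne_zero d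
  have hs : MeasurableSet {S : Fin n → EuclideanSpace ℝ (Fin d) | simplexDet (S ∘ p) ≠ 0} :=
    (measurableSet_eq_fun (continuous_simplexDet.comp
      (by fun_prop : Continuous fun S : Fin n → EuclideanSpace ℝ (Fin d) => S ∘ p)).measurable
      measurable_const).compl
  let L : ℝ →ₗ[ℝ] Fin n → EuclideanSpace ℝ (Fin d) :=
    LinearMap.toSpanSingleton ℝ _ (Function.extend p a 0)
  refine ae_mem_of_ae_add_linearMap_mem L volume
    (volume : Measure (Fin n → EuclideanSpace ℝ (Fin d))) hs fun S => ?_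
  refine (ae_simplexDet_add_smul_ne_zero (S ∘ p) a ha).mono fun t ht => ?_
  have : (S + L t) ∘ p = S ∘ p + t • a := by
    ext i j
    simp [L, p.injective.extend_apply]
  change simplexDet ((S + L t) ∘ p) ≠ 0
  rwa [this]

theorem Function.Embedding.exists_sum_equiv {α β : Type*} [Fintype α] [Fintype β] (p : α ↪ β)
    {m : ℕ} (h : Fintype.card β = Fintype.card α + m) :
    ∃ e : α ⊕ Fin m ≃ β, ∀ a, e (Sum.inl a) = p a := by
  classical
  have hcard : Fintype.card ((Set.range p)ᶜ : Set β) = m := by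
    rw [Fintype.card_compl_set, Set.card_range_of_injective p.injective, h, Nat.add_sub_cancel_left]
  exact ⟨((Equiv.ofInjective p p.injective).sumCongr (Fintype.equivFinOfCardEq hcard).symm).trans
    (Equiv.Set.sumCompl (Set.range p)), fun a => by simp⟩

theorem simplexDet_comp_perm {d : ℕ} (u : Fin (d + 1) → EuclideanSpace ℝ (Fin d))
    (τ : Equiv.Perm (Fin (d + 1))) :
    simplexDet (u ∘ τ) = Equiv.Perm.sign τ * simplexDet u := by
  rw [simplexDet, homMatrix_comp_perm, Matrix.det_permute, simplexDet]

theorem update_comp_perm {α β : Type*} [DecidableEq α] (u : α → β) (τ : Equiv.Perm α)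
    (i : α) (x : β) : Function.update (u ∘ τ) i x = Function.update u (τ i) x ∘ τ := by
  rw [Function.update_comp_equiv, Equiv.symm_apply_apply]

theorem openSimplex_comp_perm {d : ℕ} (u : Fin (d + 1) → EuclideanSpace ℝ (Fin d))
    (τ : Equiv.Perm (Fin (d + 1))) : openSimplex (u ∘ τ) = openSimplex u := by
  have hs : ((Equiv.Perm.sign τ : ℤ) : ℝ) * ((Equiv.Perm.sign τ : ℤ) : ℝ) = 1 := by
    exact_mod_cast Int.units_coe_mul_self (Equiv.Perm.sign τ)
  ext x
  refine τ.forall_congr fun i => ?_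
  rw [update_comp_perm, simplexDet_comp_perm, simplexDet_comp_perm, mul_mul_mul_comm, hs, one_mul]

theorem wideSimplex_comp_perm {d : ℕ} (u : Fin (d + 1) → EuclideanSpace ℝ (Fin d))
    (τ : Equiv.Perm (Fin (d + 1))) : wideSimplex (u ∘ τ) = wideSimplex u := by
  ext x
  refine τ.forall_congr fun i => ?_
  rw [update_comp_perm, abs_simplexDet_comp_perm, abs_simplexDet_comp_perm]

theorem injective_of_simplexDet_ne_zero {d : ℕ} {u : Fin (d + 1) → EuclideanSpace ℝ (Fin d)}
    (hu : simplexDet u ≠ 0) : Function.Injective u := by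
  intro i j hij
  by_contra hne
  exact hu (Matrix.det_zero_of_row_eq hne (congrArg homCoord hij))

/-- A finite nondegenerate set of points contains a simplex of maximal volume which has a
facet of maximal projection along `(1, …, 1)` opposite to its first vertex. -/
theorem exists_maximal_simplex {d : ℕ} (H : Finset (EuclideanSpace ℝ (Fin d)))
    (q : Fin (d + 1) → H) (hq : simplexDet (Subtype.val ∘ q) ≠ 0) :
    ∃ p : Fin (d + 1) → H, simplexDet (Subtype.val ∘ p) ≠ 0 ∧
      (∀ j, |facetDet (Subtype.val ∘ p) j| ≤ |facetDet (Subtype.val ∘ p) 0|) ∧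
      ∀ x ∈ H, x ∈ wideSimplex (Subtype.val ∘ p) := by
  have : Nonempty (Fin (d + 1) → H) := ⟨q⟩
  obtain ⟨p, hp⟩ := Finite.exists_max fun p : Fin (d + 1) → H =>
    toLex (|simplexDet (Subtype.val ∘ p)|, |facetDet (Subtype.val ∘ p) 0|)
  have hmax : ∀ p', |simplexDet (Subtype.val ∘ p')| ≤ |simplexDet (Subtype.val ∘ p)| := fun p' => by
    rcases (Prod.Lex.toLex_le_toLex).1 (hp p') with h | h
    exacts [h.le, h.1.le]
  refine ⟨p, abs_pos.1 ((abs_pos.2 hq).trans_le (hmax q)), fun j => ?_, fun x hx i => ?_⟩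
  · rcases (Prod.Lex.toLex_le_toLex).1 (hp (p ∘ Equiv.swap 0 j)) with h | h
    · rw [← Function.comp_assoc, abs_simplexDet_comp_perm] at h
      exact absurd h (lt_irrefl _)
    · have := h.2
      rwa [← Function.comp_assoc, abs_facetDet_comp_perm, Equiv.swap_apply_left] at this
  · have := hmax (Function.update p i ⟨x, hx⟩)
    rwa [Function.comp_update] at this

/-- The event that the points indexed by the first component of `φ` span a nondegenerate simplex
with empty interior, which has a facet of maximal projection along `(1, …, 1)` opposite to its first
vertex and has maximal volume with respect to exchanges with the other points indexed by `φ`. -/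
def holeEvent {d m n : ℕ} (φ : Fin (d + 1) ⊕ Fin m → Fin n) :
    Set (Fin n → EuclideanSpace ℝ (Fin d)) :=
  {S | (simplexDet (S ∘ φ ∘ Sum.inl) ≠ 0 ∧
      ∀ j, |facetDet (S ∘ φ ∘ Sum.inl) j| ≤ |facetDet (S ∘ φ ∘ Sum.inl) 0|) ∧
    (∀ j, S (φ (Sum.inr j)) ∈ wideSimplex (S ∘ φ ∘ Sum.inl)) ∧
    ∀ l, S l ∉ openSimplex (S ∘ φ ∘ Sum.inl)}

theorem mem_holeEvent_comp {d m n : ℕ} {φ : Fin (d + 1) ⊕ Fin m → Fin n}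
    {S : Fin n → EuclideanSpace ℝ (Fin d)} (hS : S ∈ holeEvent φ)
    {τ : Equiv.Perm (Fin (d + 1))} (hτ : τ 0 = 0) (σ : Equiv.Perm (Fin m)) :
    S ∈ holeEvent (φ ∘ τ.sumCongr σ) := by
  obtain ⟨⟨h1, h2⟩, h3, h4⟩ := hS
  have h : S ∘ (φ ∘ τ.sumCongr σ) ∘ Sum.inl = (S ∘ φ ∘ Sum.inl) ∘ τ := by ext; simp
  refine ⟨⟨?_, fun j => ?_⟩, fun j => ?_, fun l => ?_⟩
  · rw [h, ← abs_pos, abs_simplexDet_comp_perm]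
    exact abs_pos.2 h1
  · rw [h, abs_facetDet_comp_perm, abs_facetDet_comp_perm, hτ]
    exact h2 _
  · rw [h, wideSimplex_comp_perm]
    exact h3 _
  · rw [h, openSimplex_comp_perm]
    exact h4 l

theorem exists_mem_holeEvent {d m n : ℕ} {S : Fin n → EuclideanSpace ℝ (Fin d)}
    (hS : ∀ p : Fin (d + 1) ↪ Fin n, simplexDet (S ∘ p) ≠ 0)
    {H : Finset (EuclideanSpace ℝ (Fin d))}
    (hHS : (H : Set (EuclideanSpace ℝ (Fin d))) ⊆ Set.range S)
    (hcard : H.card = d + 1 + m)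
    (hempty : interior (convexHull ℝ (H : Set (EuclideanSpace ℝ (Fin d)))) ∩ Set.range S = ∅) :
    ∃ φ : Fin (d + 1) ⊕ Fin m ↪ Fin n, Set.range (S ∘ φ) = H ∧ S ∈ holeEvent φ := by
  choose f hf using fun x : H => hHS x.2
  have hf_inj : Function.Injective f := fun x y h => by
    rw [Subtype.ext_iff, ← hf x, ← hf y, h]
  obtain ⟨q⟩ : Nonempty (Fin (d + 1) ↪ H) :=
    Function.Embedding.nonempty_of_card_le (by simp [hcard])
  have hq : simplexDet (Subtype.val ∘ q) ≠ 0 := by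
    have := hS (q.trans ⟨f, hf_inj⟩)
    rwa [show S ∘ q.trans ⟨f, hf_inj⟩ = Subtype.val ∘ q from funext fun i => hf (q i)] at this
  obtain ⟨p, hp0, hp1, hp2⟩ := exists_maximal_simplex H q hq
  obtain ⟨e, he⟩ := Function.Embedding.exists_sum_equiv
    ⟨p, (injective_of_simplexDet_ne_zero hp0).of_comp⟩ (m := m) (by simp [hcard])
  have hp : S ∘ (f ∘ e) ∘ Sum.inl = Subtype.val ∘ p := funext fun i => by simp [hf, he]
  refine ⟨e.toEmbedding.trans ⟨f, hf_inj⟩, ?_, ⟨?_, ?_⟩, fun j => ?_, fun l hl => ?_⟩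
  · change Set.range (S ∘ f ∘ e) = H
    rw [← Function.comp_assoc, e.surjective.range_comp, show S ∘ f = Subtype.val from funext hf,
      Subtype.range_coe]
  · exact hp ▸ hp0
  · exact hp ▸ hp1
  · change S (f (e (Sum.inr j))) ∈ wideSimplex (S ∘ (f ∘ e) ∘ Sum.inl)
    rw [hp, hf]
    exact hp2 _ (e _).2
  · change S l ∈ openSimplex (S ∘ (f ∘ e) ∘ Sum.inl) at hl
    rw [hp] at hl
    have hsub : Set.range (Subtype.val ∘ p) ⊆ (H : Set (EuclideanSpace ℝ (Fin d))) := by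
      rintro _ ⟨i, rfl⟩
      exact (p i).2
    exact (hempty.subset ⟨interior_mono (convexHull_mono hsub)
      (openSimplex_subset_interior _ hl), l, rfl⟩).elim

/-- Every subset of `S` of size `d + 2 + m` whose convex hull has no point of `S` in its interior
gives rise to at least `(d + 1)! m!` index maps `φ` with `S ∈ holeEvent φ`. -/
theorem ncard_mul_factorial_le {d m n : ℕ} {S : Fin n → EuclideanSpace ℝ (Fin (d + 1))}
    (hS : ∀ p : Fin (d + 2) ↪ Fin n, simplexDet (S ∘ p) ≠ 0)
    {𝓗 : Set (Finset (EuclideanSpace ℝ (Fin (d + 1))))}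
    (h𝓗 : ∀ H ∈ 𝓗, (H : Set (EuclideanSpace ℝ (Fin (d + 1)))) ⊆ Set.range S ∧
      H.card = d + 2 + m ∧
      interior (convexHull ℝ (H : Set (EuclideanSpace ℝ (Fin (d + 1))))) ∩ Set.range S = ∅) :
    𝓗.ncard * ((d + 1).factorial * m.factorial) ≤
      Nat.card {φ : Fin (d + 2) ⊕ Fin m ↪ Fin n // S ∈ holeEvent φ} := by
  choose φ hφ hφS using fun H : 𝓗 =>
    exists_mem_holeEvent hS (h𝓗 H H.2).1 (h𝓗 H H.2).2.1 (h𝓗 H H.2).2.2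
  let F : 𝓗 × Equiv.Perm (Fin (d + 1)) × Equiv.Perm (Fin m) →
      {φ : Fin (d + 2) ⊕ Fin m ↪ Fin n // S ∈ holeEvent φ} := fun x =>
    ⟨((Equiv.Perm.decomposeFin.symm (0, x.2.1)).sumCongr x.2.2).toEmbedding.trans (φ x.1),
      mem_holeEvent_comp (hφS x.1) (by simp) x.2.2⟩
  have hF : Function.Injective F := by
    rintro ⟨H, τ, σ⟩ ⟨H', τ', σ'⟩ h
    have h1 : ∀ x, φ H ((Equiv.Perm.decomposeFin.symm (0, τ)).sumCongr σ x) =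
        φ H' ((Equiv.Perm.decomposeFin.symm (0, τ')).sumCongr σ' x) := fun x =>
      DFunLike.congr_fun (congrArg Subtype.val h) x
    have hH : H = H' := by
      refine Subtype.ext (Finset.coe_injective ?_)
      rw [← hφ H, ← hφ H',
        ← ((Equiv.Perm.decomposeFin.symm (0, τ)).sumCongr σ).surjective.range_comp (S ∘ φ H),
        ← ((Equiv.Perm.decomposeFin.symm (0, τ')).sumCongr σ').surjective.range_comp (S ∘ φ H')]
      congr 1
      exact funext fun x => congrArg S (h1 x)
    subst hH
    have h2 := fun x => (φ H).injective (h1 x)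
    have hτ : ((0 : Fin (d + 2)), τ) = (0, τ') := Equiv.Perm.decomposeFin.symm.injective
      (Equiv.ext fun i => Sum.inl_injective (h2 (Sum.inl i)))
    have hσ : σ = σ' := Equiv.ext fun i => Sum.inr_injective (h2 (Sum.inr i))
    rw [hσ, (Prod.mk.inj hτ).2]
  have := Nat.card_le_card_of_injective F hF
  rwa [Nat.card_prod, Nat.card_prod, Nat.card_coe_set_eq, Nat.card_eq_fintype_card,
    Nat.card_eq_fintype_card, Fintype.card_perm, Fintype.card_perm, Fintype.card_fin,
    Fintype.card_fin] at this

theorem pi_holeEvent_le {d : ℕ} [NeZero d] {m r n : ℕ} {K : Set (EuclideanSpace ℝ (Fin (d + 1)))}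
    (hKm : MeasurableSet K) (hKconv : Convex ℝ K) (hKvol : volume K = 1)
    (hn : n = d + 2 + m + r) (φ : Fin (d + 2) ⊕ Fin m ↪ Fin n) :
    Measure.pi (fun _ : Fin n => volume.restrict K) (holeEvent φ) ≤
      ENNReal.ofReal (2 ^ d * ((d + 1).factorial * (2 ^ (d + 1) * (d + 1).factorial) ^ m *
        (m.factorial * r.factorial / (m + r + 1).factorial))) := by
  obtain ⟨e, he⟩ := φ.exists_sum_equiv (m := r) (by simp [hn])
  refine (measure_mono ?_).trans
    (pi_hole_event_le hKm hKconv hKvol ((Equiv.sumAssoc _ _ _).symm.trans e))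
  have h : ((Equiv.sumAssoc (Fin (d + 2)) (Fin m) (Fin r)).symm.trans e) ∘ Sum.inl =
      φ ∘ Sum.inl := funext fun i => by simp [he]
  rintro S ⟨h1, h2, h3⟩
  rw [Set.mem_ofPred_eq, h]
  refine ⟨h1, fun j => ?_, fun j => h3 _⟩
  simpa [he] using h2 j

theorem integral_natCast_le_of_mul_le_card {Ω ι : Type*} [MeasurableSpace Ω] [Fintype ι]
    {μ : Measure Ω} {N : Ω → ℕ} {A : ι → Set Ω} {c : ℕ} (hc : 0 < c)
    (hN : ∀ᵐ ω ∂μ, N ω * c ≤ Nat.card {i // ω ∈ A i}) {B : ℝ} (hB : 0 ≤ B)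
    (hA : ∀ i, μ (A i) ≤ ENNReal.ofReal B) :
    ∫ ω, (N ω : ℝ) ∂μ ≤ Fintype.card ι * B / c := by
  classical
  have hc' : (0 : ℝ) < c := by exact_mod_cast hc
  have hAint : ∀ i, Integrable ((toMeasurable μ (A i)).indicator fun _ => (1 : ℝ)) μ := fun i =>
    (integrable_indicator_iff (measurableSet_toMeasurable _ _)).2
      (integrableOn_const (by
        rw [measure_toMeasurable]
        exact ((hA i).trans_lt ENNReal.ofReal_lt_top).ne))
  calc ∫ ω, (N ω : ℝ) ∂μ
      ≤ ∫ ω, (∑ i, (toMeasurable μ (A i)).indicator (fun _ => (1 : ℝ)) ω) / c ∂μ := by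
        refine integral_mono_of_nonneg (.of_forall fun ω => Nat.cast_nonneg _)
          ((integrable_finsetSum _ fun i _ => hAint i).div_const _) ?_
        filter_upwards [hN] with ω hω
        rw [le_div_iff₀ hc']
        calc (N ω : ℝ) * c ≤ (Nat.card {i // ω ∈ A i} : ℝ) := by exact_mod_cast hω
          _ = ∑ i, (A i).indicator (fun _ => (1 : ℝ)) ω := by
            rw [Nat.card_eq_fintype_card, Fintype.card_subtype]
            simp [Set.indicator_apply]
          _ ≤ _ := Finset.sum_le_sum fun i _ =>
            Set.indicator_le_indicator_of_subset (subset_toMeasurable _ _)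
              (fun _ => zero_le_one) _
    _ = (∑ i, μ.real (A i)) / c := by
        rw [integral_div, integral_finsetSum _ fun i _ => hAint i]
        simp only [integral_indicator_const _ (measurableSet_toMeasurable _ _), Measure.real,
          measure_toMeasurable, smul_eq_mul, mul_one]
    _ ≤ Fintype.card ι * B / c := by
        gcongr
        rw [← nsmul_eq_mul]
        exact Finset.sum_le_card_nsmul _ _ _ fun i _ =>
          (ENNReal.toReal_mono ENNReal.ofReal_ne_top (hA i)).trans_eq (ENNReal.toReal_ofReal hB)

theorem le_choose_succ (n j : ℕ) : n ≤ (n + j).choose (j + 1) := by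
  induction j with
  | zero => simp
  | succ j ih => exact ih.trans (Nat.choose_succ_succ _ _ ▸ Nat.le_add_right _ _)

theorem two_pow_mul_factorial_le {d : ℕ} (hd : 2 ≤ d) :
    2 ^ d * d.factorial ≤ 2 * d ^ (2 * d - 1) := by
  obtain ⟨e, rfl⟩ : ∃ e, d = e + 1 := ⟨d - 1, by lia⟩
  calc 2 ^ (e + 1) * (e + 1).factorial
      ≤ 2 * (e + 1) ^ e * (e + 1) ^ (e + 1) := by
        rw [pow_succ']
        gcongr
        exact Nat.factorial_le_pow _
    _ = 2 * (e + 1) ^ (2 * (e + 1) - 1) := by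
        rw [mul_assoc, ← pow_add]
        congr 2
        lia

theorem hole_bound_le {d m r : ℕ} (hd : 1 ≤ d) :
    ((d + 2 + m + r).descFactorial (d + 2 + m) : ℝ) *
        (2 ^ d * ((d + 1).factorial * (2 ^ (d + 1) * (d + 1).factorial) ^ m *
          (m.factorial * r.factorial / (m + r + 1).factorial))) /
        ((d + 1).factorial * m.factorial : ℕ) ≤
      2 ^ d * (2 * ((d + 1 : ℕ) : ℝ) ^ (2 * (d + 1) - 1) *
          ((d + 2 + m).choose ((d + 1) / 2) : ℝ)) ^ m *
        ((d + 2 + m + r).descFactorial (d + 1 + m) : ℝ) /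
        (m.factorial * ((r : ℝ) + 1) ^ m) := by
  have h1 : ((d + 2 + m + r).descFactorial (d + 2 + m) : ℝ) =
      (d + 2 + m + r).factorial / r.factorial := by
    rw [eq_div_iff (by positivity), mul_comm, ← Nat.cast_mul,
      ← Nat.factorial_mul_descFactorial (Nat.le_add_right (d + 2 + m) r), Nat.add_sub_cancel_left]
  have h2 : ((d + 2 + m + r).descFactorial (d + 1 + m) : ℝ) =
      (d + 2 + m + r).factorial / (r + 1).factorial := by
    rw [eq_div_iff (by positivity), mul_comm, ← Nat.cast_mul,
      ← Nat.factorial_mul_descFactorial (by lia : d + 1 + m ≤ d + 2 + m + r),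
      show d + 2 + m + r - (d + 1 + m) = r + 1 by lia]
  have h3 : ((r + 1).factorial : ℝ) * (r + 1) ^ m ≤ (m + r + 1).factorial := by
    calc ((r + 1).factorial : ℝ) * (r + 1) ^ m
        ≤ (r + 1).factorial * ((r + 1 + 1 : ℕ) : ℝ) ^ m := by
          gcongr
          push_cast
          linarith
      _ ≤ (r + 1 + m).factorial := by exact_mod_cast Nat.factorial_mul_pow_le_factorial
      _ = (m + r + 1).factorial := by rw [show r + 1 + m = m + r + 1 by lia]
  have h4 : (m.factorial : ℝ) ≤ ((d + 2 + m).choose ((d + 1) / 2) : ℝ) ^ m := by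
    have h : m ≤ (d + 2 + m).choose ((d + 1) / 2) := by
      obtain ⟨j, hj⟩ : ∃ j, (d + 1) / 2 = j + 1 := ⟨(d + 1) / 2 - 1, by lia⟩
      rw [hj]
      exact (le_choose_succ m j).trans (Nat.choose_le_choose _ (by lia))
    exact_mod_cast (Nat.factorial_le_pow m).trans (Nat.pow_le_pow_left h m)
  have h5 : (2 : ℝ) ^ (d + 1) * (d + 1).factorial ≤ 2 * ((d + 1 : ℕ) : ℝ) ^ (2 * (d + 1) - 1) := by
    exact_mod_cast two_pow_mul_factorial_le (by lia)
  calc _ = 2 ^ d * (2 ^ (d + 1) * ((d + 1).factorial : ℝ)) ^ m * (d + 2 + m + r).factorial *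
          (1 / (m + r + 1).factorial) := by
        rw [h1]
        push_cast
        field_simp
    _ ≤ 2 ^ d * (2 * ((d + 1 : ℕ) : ℝ) ^ (2 * (d + 1) - 1)) ^ m * (d + 2 + m + r).factorial *
          (((d + 2 + m).choose ((d + 1) / 2) : ℝ) ^ m / m.factorial /
            ((r + 1).factorial * (r + 1) ^ m)) := by
        gcongr
        rwa [one_le_div (by positivity)]
    _ = _ := by
        rw [h2, mul_pow (2 * ((d + 1 : ℕ) : ℝ) ^ (2 * (d + 1) - 1))]
        field_simp

/-- Let `d ≥ 2`, `k ≥ d+1`, let `K ⊆ ℝ^d` be a convex body of volume `1`, and let `S` be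
`n ≥ k` points chosen independently and uniformly at random from `K`. The expected number of
`k`-holes in `S` is at most
`2^{d-1} · (2 d^{2d-1} binom(k,⌊d/2⌋))^{k-d-1} · n(n-1)⋯(n-k+2) / ((k-d-1)! (n-k+1)^{k-d-1})`. -/
theorem expected_k_holes_le
    (d k n : ℕ) (hd : 2 ≤ d) (hk : d + 1 ≤ k) (hn : k ≤ n)
    (K : Set (EuclideanSpace ℝ (Fin d)))
    (hKcomp : IsCompact K) (hKconv : Convex ℝ K) (hKint : (interior K).Nonempty)
    (hKvol : volume K = 1) :
    (∫ S : Fin n → EuclideanSpace ℝ (Fin d),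
      (Set.ncard {H : Finset (EuclideanSpace ℝ (Fin d)) |
        (H : Set (EuclideanSpace ℝ (Fin d))) ⊆ Set.range S ∧ H.card = k ∧
        (∀ p ∈ H, p ∉ convexHull ℝ ((H : Set (EuclideanSpace ℝ (Fin d))) \ {p})) ∧
        interior (convexHull ℝ (H : Set (EuclideanSpace ℝ (Fin d)))) ∩ Set.range S = ∅} : ℝ)
      ∂(Measure.pi fun _ : Fin n => volume.restrict K))
    ≤ 2 ^ (d - 1) * (2 * (d : ℝ) ^ (2 * d - 1) * (k.choose (d / 2) : ℝ)) ^ (k - d - 1)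
        * (n.descFactorial (k - 1) : ℝ)
        / ((Nat.factorial (k - d - 1) : ℝ) * ((n : ℝ) - k + 1) ^ (k - d - 1)) := by
  obtain ⟨d, rfl⟩ : ∃ e, d = e + 1 := ⟨d - 1, by lia⟩
  obtain ⟨m, rfl⟩ : ∃ m, k = d + 2 + m := ⟨k - (d + 2), by lia⟩
  obtain ⟨r, rfl⟩ : ∃ r, n = d + 2 + m + r := ⟨n - (d + 2 + m), by lia⟩
  have : NeZero d := ⟨by lia⟩
  have hae : ∀ᵐ S ∂(Measure.pi fun _ : Fin (d + 2 + m + r) =>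
      (volume : Measure (EuclideanSpace ℝ (Fin (d + 1)))).restrict K),
      ∀ p : Fin (d + 2) ↪ Fin (d + 2 + m + r), simplexDet (S ∘ p) ≠ 0 :=
    ae_all_iff.2 fun p => ae_simplexDet_comp_ne_zero K p
  refine (integral_natCast_le_of_mul_le_card
    (A := fun φ : Fin (d + 2) ⊕ Fin m ↪ Fin (d + 2 + m + r) => holeEvent φ)
    (mul_pos (d + 1).factorial_pos m.factorial_pos)
    (hae.mono fun S hS => ncard_mul_factorial_le hS fun H hH => ⟨hH.1, hH.2.1, hH.2.2.2⟩)
    (by positivity)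
    (pi_holeEvent_le hKcomp.measurableSet hKconv hKvol rfl)).trans ?_
  rw [Fintype.card_embedding_eq, Fintype.card_sum, Fintype.card_fin, Fintype.card_fin,
    Fintype.card_fin, show d + 2 + m - (d + 1) - 1 = m by lia,
    show d + 2 + m - 1 = d + 1 + m by lia, Nat.add_sub_cancel,
    show ((d + 2 + m + r : ℕ) : ℝ) - (d + 2 + m : ℕ) + 1 = r + 1 by push_cast; ring]
  exact hole_bound_le (by lia)
end
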